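/- arXiv:1207.2369 — 10 statements merged into one kernel-verified Lean document; each statement's English description precedes it below -/
import Mathlib

section
/- Let f : I ⊆ [0,∞) → ℝ be differentiable on I° with f' integrable on [a,b], where a,b ∈ I° with a < b, let λ, μ ∈ [0,1], and suppose |f'|^q is (α,m)-convex on [a,b] for some (α,m) ∈ (0,1]² with mb > a and q ≥ 1. Define ε₁ = −μ²/2 + λ(1−μ)μ, ε₂ = (λ(1−μ))² − ε₁, ε₃ = (1−λμ)² − (1−λμ)(1+μ) + (1+μ²)/2, ε₄ = (1−μ²)/2 − (1−λμ)(1−μ), δ₁ = λ(1−μ)μ^{α+1}/(α+1) − μ^{α+2}/(α+2), δ₂ = λ(1−μ)μ − μ²/2 − δ₁, δ₃ = 2(λ(1−μ))^{α+2}/((α+1)(α+2)) − λ(1−μ)μ^{α+1}/(α+1) + μ^{α+2}/(α+2), δ₄ = (λ(1−μ))² − λμ(1−μ) + μ²/2 − δ₃, β₁ = 2(1−λμ)^{α+2}/((α+1)(α+2)) − (1−λμ)(1+μ^{α+1})/(α+1) + (1+μ^{α+2})/(α+2), β₂ = (1−λμ)² − (1−λμ)(1+μ) + (1+μ²)/2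 − β₁, β₃ = (1−μ^{α+2})/(α+2) − (1−λμ)(1−μ^{α+1})/(α+1), β₄ = (1−λμ)(μ−1) + (1−μ²)/2 − β₃. Then, writing E = |λ(μ f(a) + (1−μ) f(mb)) + (1−λ) f(μa + m(1−μ)b) − (1/(mb−a)) ∫ₐ^{mb} f(x) dx|: if λ(1−μ) ≤ μ ≤ 1−λμ, then E ≤ (mb−a)[ ε₂^{1−1/q}(δ₃|f'(a)|^q + m δ₄|f'(b)|^q)^{1/q} + ε₃^{1−1/q}(β₁|f'(a)|^q + m β₂|f'(b)|^q)^{1/q} ]; if μ ≤ λ(1−μ) ≤ 1−λμ, then E ≤ (mb−a)[ ε₁^{1−1/q}(δ₁|f'(a)|^q + m δ₂|f'(b)|^q)^{1/q} + ε₃^{1−1/q}(β₁|f'(a)|^q + m β₂|f'(b)|^q)^{1/q} ]; if λ(1−μ) ≤ 1−λμ ≤ μ, then E ≤ (mb−a)[ ε₂^{1−1/q}(δ₃|f'(a)|^q + m δ₄|f'(b)|^q)^{1/q} + ε₄^{1−1/q}(β₃|f'(a)|^q + m β₄|f'(b)|^q)^{1/q} ]. -/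
open MeasureTheory Set Real

/-- A function `g` is `(α,m)`-convex on `s` if
`g (t*x + m*(1-t)*y) ≤ t^α * g x + m*(1-t^α) * g y` for all `x, y ∈ s` and `t ∈ [0,1]`. -/
def AlphaMConvexOn (s : Set ℝ) (α m : ℝ) (g : ℝ → ℝ) : Prop :=
  ∀ x ∈ s, ∀ y ∈ s, ∀ t ∈ Icc (0:ℝ) 1,
    g (t * x + m * (1 - t) * y) ≤ t ^ α * g x + m * (1 - t ^ α) * g y

/-- The weighted power mean inequality on an interval, for continuous data. -/
theorem integral_mul_rpow_one_div_le {u v q : ℝ} (huv : u ≤ v) (hq : 1 ≤ q) {w k : ℝ → ℝ}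
    (hw : Continuous w) (hk : Continuous k) (hw0 : ∀ t ∈ Icc u v, 0 ≤ w t)
    (hk0 : ∀ t ∈ Icc u v, 0 ≤ k t) :
    ∫ t in u..v, w t * k t ^ (1 / q) ≤
      (∫ t in u..v, w t) ^ (1 - 1 / q) * (∫ t in u..v, w t * k t) ^ (1 / q) := by
  rcases hq.eq_or_lt with rfl | hq1
  · simp
  have hpq : q.conjExponent.HolderConjugate q := (Real.HolderConjugate.conjExponent hq1).symm
  have hp_inv : 1 / q.conjExponent = 1 - 1 / q := by
    have := hpq.inv_add_inv_eq_one
    simp only [one_div]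
    linarith
  have hq0 : 0 < 1 / q := by positivity
  have hq1' : 0 < 1 - 1 / q := by rw [← hp_inv]; exact one_div_pos.2 hpq.pos
  have hmem : ∀ t ∈ Ioc u v, t ∈ Icc u v := fun t ht => Ioc_subset_Icc_self ht
  have hmemLp : ∀ (F : ℝ → ℝ) (p : ENNReal), Continuous F →
      MemLp F p (volume.restrict (Ioc u v)) := by
    intro F p hF
    obtain ⟨C, hC⟩ := isCompact_Icc.exists_bound_of_continuousOn (s := Icc u v) hF.continuousOn
    refine MemLp.of_bound hF.aestronglyMeasurable C ?_
    exact (ae_restrict_mem measurableSet_Ioc).mono fun t ht => hC t (hmem t ht)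
  have hF : Continuous fun t => w t ^ (1 - 1 / q) :=
    hw.rpow_const fun _ => Or.inr hq1'.le
  have hG : Continuous fun t => w t ^ (1 / q) * k t ^ (1 / q) :=
    (hw.rpow_const fun _ => Or.inr hq0.le).mul (hk.rpow_const fun _ => Or.inr hq0.le)
  have hholder := integral_mul_le_Lp_mul_Lq_of_nonneg (μ := volume.restrict (Ioc u v)) hpq
    (f := fun t => w t ^ (1 - 1 / q)) (g := fun t => w t ^ (1 / q) * k t ^ (1 / q))
    ((ae_restrict_mem measurableSet_Ioc).mono fun t ht => rpow_nonneg (hw0 t (hmem t ht)) _)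
    ((ae_restrict_mem measurableSet_Ioc).mono fun t ht =>
      mul_nonneg (rpow_nonneg (hw0 t (hmem t ht)) _) (rpow_nonneg (hk0 t (hmem t ht)) _))
    (hmemLp _ _ hF) (hmemLp _ _ hG)
  rw [hp_inv] at hholder
  simp only [intervalIntegral.integral_of_le huv]
  convert hholder using 1
  · refine setIntegral_congr_fun measurableSet_Ioc fun t ht => ?_
    have h0 := hw0 t (hmem t ht)
    rw [← mul_assoc, ← rpow_add_of_nonneg h0 hq1'.le hq0.le, sub_add_cancel, rpow_one]
  · congr 2
    · refine setIntegral_congr_fun measurableSet_Ioc fun t ht => ?_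
      have h0 := hw0 t (hmem t ht)
      rw [← hp_inv, ← rpow_mul h0, one_div, inv_mul_cancel₀ hpq.ne_zero, rpow_one]
    · refine setIntegral_congr_fun measurableSet_Ioc fun t ht => ?_
      have h0 := hw0 t (hmem t ht)
      have h1 := hk0 t (hmem t ht)
      have hqne : q ≠ 0 := by positivity
      rw [← mul_rpow h0 h1, ← rpow_mul (mul_nonneg h0 h1), one_div, inv_mul_cancel₀ hqne, rpow_one]

theorem integral_abs_sub_mul_le {u v c m α q P Q : ℝ} (huv : u ≤ v) (hα : 0 ≤ α) (hq : 1 ≤ q)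
    {h : ℝ → ℝ} (hh : IntervalIntegrable h volume u v) (hh0 : ∀ t ∈ Icc u v, 0 ≤ h t)
    (hle : ∀ t ∈ Icc u v, h t ^ q ≤ t ^ α * P + m * (1 - t ^ α) * Q) {W D : ℝ}
    (hW : ∫ t in u..v, |t - c| * t ^ (0 : ℝ) = W) (hD : ∫ t in u..v, |t - c| * t ^ α = D) :
    ∫ t in u..v, |t - c| * h t ≤ W ^ (1 - 1 / q) * (D * P + m * (W - D) * Q) ^ (1 / q) := by
  have hw : Continuous fun t : ℝ => |t - c| := by fun_prop
  have hpow : Continuous fun t : ℝ => t ^ α := continuous_id.rpow_const fun _ => Or.inr hα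
  have hwpow : Continuous fun t : ℝ => |t - c| * t ^ α := hw.mul hpow
  have hk : Continuous fun t : ℝ => t ^ α * P + m * (1 - t ^ α) * Q := by fun_prop
  have hkq : Continuous fun t : ℝ => (t ^ α * P + m * (1 - t ^ α) * Q) ^ (1 / q) :=
    hk.rpow_const fun _ => Or.inr (by positivity)
  have hk0 : ∀ t ∈ Icc u v, 0 ≤ t ^ α * P + m * (1 - t ^ α) * Q := fun t ht =>
    (rpow_nonneg (hh0 t ht) q).trans (hle t ht)
  simp only [rpow_zero, mul_one] at hW
  have hDP : ∫ t in u..v, |t - c| * (t ^ α * P + m * (1 - t ^ α) * Q) =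
      D * P + m * (W - D) * Q := by
    have hsplit : ∀ t : ℝ, |t - c| * (t ^ α * P + m * (1 - t ^ α) * Q) =
        (P - m * Q) * (|t - c| * t ^ α) + m * Q * |t - c| := fun t => by ring
    simp only [hsplit]
    rw [intervalIntegral.integral_add
      ((hwpow.intervalIntegrable _ _).const_mul _) ((hw.intervalIntegrable _ _).const_mul _),
      intervalIntegral.integral_const_mul, intervalIntegral.integral_const_mul, hW, hD]
    ring
  calc ∫ t in u..v, |t - c| * h t
      ≤ ∫ t in u..v, |t - c| * (t ^ α * P + m * (1 - t ^ α) * Q) ^ (1 / q) := by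
        refine intervalIntegral.integral_mono_on huv (hh.continuousOn_mul hw.continuousOn)
          ((hw.mul hkq).intervalIntegrable _ _) fun t ht => ?_
        refine mul_le_mul_of_nonneg_left ?_ (abs_nonneg _)
        have hqne : q ≠ 0 := by positivity
        calc h t = (h t ^ q) ^ (1 / q) := by
              rw [← rpow_mul (hh0 t ht), mul_one_div_cancel hqne, rpow_one]
          _ ≤ _ := rpow_le_rpow (rpow_nonneg (hh0 t ht) _) (hle t ht) (by positivity)
    _ ≤ _ := by
        have := integral_mul_rpow_one_div_le huv hq hw hk (fun t _ => abs_nonneg _) hk0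
        rwa [hDP, hW] at this

theorem integral_sub_mul_rpow {u v c p : ℝ} (hu : 0 ≤ u) (huv : u ≤ v) (hp : 0 ≤ p) :
    ∫ t in u..v, (c - t) * t ^ p =
      (c * v ^ (p + 1) / (p + 1) - v ^ (p + 2) / (p + 2)) -
        (c * u ^ (p + 1) / (p + 1) - u ^ (p + 2) / (p + 2)) := by
  have hcongr : ∫ t in u..v, (c - t) * t ^ p = ∫ t in u..v, (c * t ^ p - t ^ (p + 1)) := by
    refine intervalIntegral.integral_congr fun t ht => ?_
    rw [uIcc_of_le huv] at ht
    rw [rpow_add_of_nonneg (hu.trans ht.1) hp zero_le_one, rpow_one]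
    ring
  rw [hcongr, intervalIntegral.integral_sub
    ((intervalIntegral.intervalIntegrable_rpow' (by linarith)).const_mul _)
    (intervalIntegral.intervalIntegrable_rpow' (by linarith)),
    intervalIntegral.integral_const_mul, integral_rpow (Or.inl (by linarith)),
    integral_rpow (Or.inl (by linarith)), show p + 1 + 1 = p + 2 by ring]
  ring

theorem integral_abs_sub_mul_rpow_of_le {u v c p : ℝ} (hu : 0 ≤ u) (huv : u ≤ v) (hp : 0 ≤ p)
    (hc : v ≤ c) :
    ∫ t in u..v, |t - c| * t ^ p =
      (c * v ^ (p + 1) / (p + 1) - v ^ (p + 2) / (p + 2)) -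
        (c * u ^ (p + 1) / (p + 1) - u ^ (p + 2) / (p + 2)) := by
  rw [← integral_sub_mul_rpow hu huv hp]
  refine intervalIntegral.integral_congr fun t ht => ?_
  rw [uIcc_of_le huv] at ht
  rw [abs_of_nonpos (by linarith [ht.2]), neg_sub]

theorem integral_abs_sub_mul_rpow_of_ge {u v c p : ℝ} (hu : 0 ≤ u) (huv : u ≤ v) (hp : 0 ≤ p)
    (hc : c ≤ u) :
    ∫ t in u..v, |t - c| * t ^ p =
      (c * u ^ (p + 1) / (p + 1) - u ^ (p + 2) / (p + 2)) -
        (c * v ^ (p + 1) / (p + 1) - v ^ (p + 2) / (p + 2)) := by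
  rw [← neg_sub (c * v ^ (p + 1) / (p + 1) - v ^ (p + 2) / (p + 2)),
    ← integral_sub_mul_rpow hu huv hp, ← intervalIntegral.integral_neg]
  refine intervalIntegral.integral_congr fun t ht => ?_
  rw [uIcc_of_le huv] at ht
  rw [abs_of_nonneg (by linarith [ht.1])]
  ring

theorem integral_abs_sub_mul_rpow_of_mem {u v c p : ℝ} (hu : 0 ≤ u) (hp : 0 ≤ p)
    (huc : u ≤ c) (hcv : c ≤ v) :
    ∫ t in u..v, |t - c| * t ^ p =
      2 * c ^ (p + 2) / ((p + 1) * (p + 2)) - (c * u ^ (p + 1) / (p + 1) - u ^ (p + 2) / (p + 2)) -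
        (c * v ^ (p + 1) / (p + 1) - v ^ (p + 2) / (p + 2)) := by
  have hcont : Continuous fun t : ℝ => |t - c| * t ^ p :=
    (by fun_prop : Continuous fun t : ℝ => |t - c|).mul
      (continuous_id.rpow_const fun _ => Or.inr hp)
  have hpow : c ^ (p + 2) = c * c ^ (p + 1) := by
    rw [show p + 2 = (p + 1) + 1 by ring,
      rpow_add_of_nonneg (hu.trans huc) (by linarith) zero_le_one, rpow_one, mul_comm]
  rw [← intervalIntegral.integral_add_adjacent_intervals (hcont.intervalIntegrable u c)
    (hcont.intervalIntegrable c v), integral_abs_sub_mul_rpow_of_le hu huc hp le_rfl,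
    integral_abs_sub_mul_rpow_of_ge (hu.trans huc) hcv hp le_rfl, hpow]
  have h1 : p + 1 ≠ 0 := by positivity
  have h2 : p + 2 ≠ 0 := by positivity
  field_simp
  ring

theorem integral_sub_mul_deriv {g g' : ℝ → ℝ} {u v c : ℝ}
    (hg : ∀ t ∈ uIcc u v, HasDerivAt g (g' t) t) (hg' : IntervalIntegrable g' volume u v) :
    ∫ t in u..v, (t - c) * g' t = (v - c) * g v - (u - c) * g u - ∫ t in u..v, g t := by
  have := intervalIntegral.integral_mul_deriv_eq_deriv_mul (u := fun t => t - c) (u' := fun _ => 1)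
    (fun t _ => (hasDerivAt_id t).sub_const c) hg (intervalIntegrable_const) hg'
  simpa using this

theorem abs_integral_sub_mul_deriv_le {g' : ℝ → ℝ} {u v c k : ℝ} (huv : u ≤ v) :
    |∫ t in u..v, (t - c) * (k * g' t)| ≤ |k| * ∫ t in u..v, |t - c| * |g' t| := by
  rw [← intervalIntegral.integral_const_mul]
  refine (intervalIntegral.abs_integral_le_integral_abs huv).trans_eq ?_
  refine intervalIntegral.integral_congr fun t _ => ?_
  simp only [abs_mul]
  ring

theorem power_mean_estimate (I : Set ℝ) (hI : I.OrdConnected) (hI0 : I ⊆ Ici (0:ℝ))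
    (f f' : ℝ → ℝ) (a b lam mu m α q : ℝ)
    (ha : a ∈ interior I) (hb : b ∈ interior I) (hab : a < b)
    (hlam : lam ∈ Icc (0:ℝ) 1) (hmu : mu ∈ Icc (0:ℝ) 1)
    (hα : α ∈ Ioc (0:ℝ) 1) (hm : m ∈ Ioc (0:ℝ) 1) (hmb : a < m * b) (hq : 1 ≤ q)
    (hdiff : ∀ x ∈ interior I, HasDerivAt f (f' x) x)
    (hint : IntervalIntegrable f' volume a b)
    (hconv : AlphaMConvexOn (Icc a b) α m (fun x => |f' x| ^ q))
    (E ε1 ε2 ε3 ε4 δ1 δ2 δ3 δ4 β1 β2 β3 β4 : ℝ)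
    (hE : E = |lam * (mu * f a + (1 - mu) * f (m * b))
        + (1 - lam) * f (mu * a + m * (1 - mu) * b)
        - (1 / (m * b - a)) * ∫ x in a..(m * b), f x|)
    (hε1 : ε1 = -(mu ^ 2) / 2 + lam * (1 - mu) * mu)
    (hε2 : ε2 = (lam * (1 - mu)) ^ 2 - ε1)
    (hε3 : ε3 = (1 - lam * mu) ^ 2 - (1 - lam * mu) * (1 + mu) + (1 + mu ^ 2) / 2)
    (hε4 : ε4 = (1 - mu ^ 2) / 2 - (1 - lam * mu) * (1 - mu))
    (hδ1 : δ1 = lam * (1 - mu) * mu ^ (α + 1) / (α + 1) - mu ^ (α + 2) / (α + 2))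
    (hδ2 : δ2 = lam * (1 - mu) * mu - mu ^ 2 / 2 - δ1)
    (hδ3 : δ3 = 2 * (lam * (1 - mu)) ^ (α + 2) / ((α + 1) * (α + 2))
        - lam * (1 - mu) * mu ^ (α + 1) / (α + 1) + mu ^ (α + 2) / (α + 2))
    (hδ4 : δ4 = (lam * (1 - mu)) ^ 2 - lam * mu * (1 - mu) + mu ^ 2 / 2 - δ3)
    (hβ1 : β1 = 2 * (1 - lam * mu) ^ (α + 2) / ((α + 1) * (α + 2))
        - (1 - lam * mu) * (1 + mu ^ (α + 1)) / (α + 1) + (1 + mu ^ (α + 2)) / (α + 2))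
    (hβ2 : β2 = (1 - lam * mu) ^ 2 - (1 - lam * mu) * (1 + mu) + (1 + mu ^ 2) / 2 - β1)
    (hβ3 : β3 = (1 - mu ^ (α + 2)) / (α + 2) - (1 - lam * mu) * (1 - mu ^ (α + 1)) / (α + 1))
    (hβ4 : β4 = (1 - lam * mu) * (mu - 1) + (1 - mu ^ 2) / 2 - β3) :
    ((lam * (1 - mu) ≤ mu ∧ mu ≤ 1 - lam * mu) →
      E ≤ (m * b - a) *
        (ε2 ^ (1 - 1 / q) * (δ3 * |f' a| ^ q + m * δ4 * |f' b| ^ q) ^ (1 / q)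
          + ε3 ^ (1 - 1 / q) * (β1 * |f' a| ^ q + m * β2 * |f' b| ^ q) ^ (1 / q))) ∧
    ((mu ≤ lam * (1 - mu) ∧ lam * (1 - mu) ≤ 1 - lam * mu) →
      E ≤ (m * b - a) *
        (ε1 ^ (1 - 1 / q) * (δ1 * |f' a| ^ q + m * δ2 * |f' b| ^ q) ^ (1 / q)
          + ε3 ^ (1 - 1 / q) * (β1 * |f' a| ^ q + m * β2 * |f' b| ^ q) ^ (1 / q))) ∧
    ((lam * (1 - mu) ≤ 1 - lam * mu ∧ 1 - lam * mu ≤ mu) →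
      E ≤ (m * b - a) *
        (ε2 ^ (1 - 1 / q) * (δ3 * |f' a| ^ q + m * δ4 * |f' b| ^ q) ^ (1 / q)
          + ε4 ^ (1 - 1 / q) * (β3 * |f' a| ^ q + m * β4 * |f' b| ^ q) ^ (1 / q))) := by
  have hlam0 := hlam.1
  have hmu0 := hmu.1
  have hmu1 := hmu.2
  have hα0 := hα.1
  have hb0 : 0 ≤ b := hI0 (interior_subset hb)
  have hmbb : m * b ≤ b := mul_le_of_le_one_left hb0 hm.2
  have hIcc : Icc a b ⊆ interior I := hI.interior.out ha hb
  set k : ℝ := a - m * b with hk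
  have hk0 : k < 0 := by linarith
  set h : ℝ → ℝ := fun t => f' (m * b + k * t) with hh
  have hx : ∀ t ∈ Icc (0 : ℝ) 1, m * b + k * t ∈ Icc a b := fun t ht => by
    constructor <;> nlinarith [ht.1, ht.2]
  have hg : ∀ t ∈ Icc (0 : ℝ) 1,
      HasDerivAt (fun t => f (m * b + k * t)) (k * h t) t := fun t ht => by
    have h1 : HasDerivAt (fun t : ℝ => m * b + k * t) k t := by
      simpa using ((hasDerivAt_id t).const_mul k).const_add (m * b)
    simpa only [hh, Function.comp_def, mul_comm k] using (hdiff _ (hIcc (hx t ht))).comp t h1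
  have hhint : IntervalIntegrable h volume 0 1 := by
    have h1 : IntervalIntegrable f' volume (m * b) a :=
      hint.mono_set (by rw [uIcc_of_ge hmb.le, uIcc_of_le hab.le]; exact Icc_subset_Icc_right hmbb)
    have h2 := (h1.comp_add_left (m * b)).comp_mul_left (c := k)
    simpa only [sub_self, zero_div, ← hk, div_self hk0.ne] using h2
  have hsub1 : Icc 0 mu ⊆ Icc (0 : ℝ) 1 := Icc_subset_Icc_right hmu1
  have hsub2 : Icc mu 1 ⊆ Icc (0 : ℝ) 1 := Icc_subset_Icc_left hmu0
  have hhint1 : IntervalIntegrable h volume 0 mu :=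
    hhint.mono_set (by rwa [uIcc_of_le hmu0, uIcc_of_le zero_le_one])
  have hhint2 : IntervalIntegrable h volume mu 1 :=
    hhint.mono_set (by rwa [uIcc_of_le hmu1, uIcc_of_le zero_le_one])
  have hgcont : ContinuousOn (fun t => f (m * b + k * t)) (Icc 0 1) := fun t ht =>
    (hg t ht).continuousAt.continuousWithinAt
  have hle : ∀ t ∈ Icc (0 : ℝ) 1,
      |h t| ^ q ≤ t ^ α * |f' a| ^ q + m * (1 - t ^ α) * |f' b| ^ q := fun t ht => by
    have := hconv a (left_mem_Icc.2 hab.le) b (right_mem_Icc.2 hab.le) t ht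
    rwa [show t * a + m * (1 - t) * b = m * b + k * t by rw [hk]; ring] at this
  have hEle : E ≤ (m * b - a) * ((∫ t in (0 : ℝ)..mu, |t - lam * (1 - mu)| * |h t|) +
      ∫ t in mu..1, |t - (1 - lam * mu)| * |h t|) := by
    have h1 := integral_sub_mul_deriv (c := lam * (1 - mu))
      (fun t ht => hg t (hsub1 (by rwa [uIcc_of_le hmu0] at ht))) (hhint1.const_mul k)
    have h2 := integral_sub_mul_deriv (c := 1 - lam * mu)
      (fun t ht => hg t (hsub2 (by rwa [uIcc_of_le hmu1] at ht))) (hhint2.const_mul k)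
    have h3 := intervalIntegral.integral_add_adjacent_intervals
      ((hgcont.mono hsub1).intervalIntegrable_of_Icc (μ := volume) hmu0)
      ((hgcont.mono hsub2).intervalIntegrable_of_Icc (μ := volume) hmu1)
    have h4 : ∫ t in (0 : ℝ)..1, f (m * b + k * t) =
        1 / (m * b - a) * ∫ x in a..m * b, f x := by
      rw [intervalIntegral.integral_comp_add_mul _ hk0.ne, intervalIntegral.integral_symm]
      simp only [mul_zero, add_zero, mul_one, smul_eq_mul, hk, add_sub_cancel]
      rw [← neg_sub (m * b) a, inv_neg, neg_mul_neg, one_div]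
    have hkey : lam * (mu * f a + (1 - mu) * f (m * b))
        + (1 - lam) * f (mu * a + m * (1 - mu) * b) - (1 / (m * b - a)) * ∫ x in a..(m * b), f x
        = (∫ t in (0 : ℝ)..mu, (t - lam * (1 - mu)) * (k * h t)) +
          ∫ t in mu..1, (t - (1 - lam * mu)) * (k * h t) := by
      rw [h1, h2, ← h4, ← h3, show mu * a + m * (1 - mu) * b = m * b + k * mu by rw [hk]; ring,
        show m * b + k * 1 = a by rw [hk]; ring, show m * b + k * 0 = m * b by ring]
      ring
    rw [hE, hkey, mul_add, show m * b - a = |k| by rw [abs_of_neg hk0, hk]; ring]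
    exact (abs_add_le _ _).trans (add_le_add (abs_integral_sub_mul_deriv_le hmu0)
      (abs_integral_sub_mul_deriv_le hmu1))
  have hleft : ∀ W D : ℝ, ∫ t in (0 : ℝ)..mu, |t - lam * (1 - mu)| * t ^ (0 : ℝ) = W →
      ∫ t in (0 : ℝ)..mu, |t - lam * (1 - mu)| * t ^ α = D →
      ∫ t in (0 : ℝ)..mu, |t - lam * (1 - mu)| * |h t| ≤
        W ^ (1 - 1 / q) * (D * |f' a| ^ q + m * (W - D) * |f' b| ^ q) ^ (1 / q) :=
    fun _ _ => integral_abs_sub_mul_le hmu0 hα0.le hq hhint1.abs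
      (fun _ _ => abs_nonneg _) fun t ht => hle t (hsub1 ht)
  have hright : ∀ W D : ℝ, ∫ t in mu..1, |t - (1 - lam * mu)| * t ^ (0 : ℝ) = W →
      ∫ t in mu..1, |t - (1 - lam * mu)| * t ^ α = D →
      ∫ t in mu..1, |t - (1 - lam * mu)| * |h t| ≤
        W ^ (1 - 1 / q) * (D * |f' a| ^ q + m * (W - D) * |f' b| ^ q) ^ (1 / q) :=
    fun _ _ => integral_abs_sub_mul_le hmu1 hα0.le hq hhint2.abs
      (fun _ _ => abs_nonneg _) fun t ht => hle t (hsub2 ht)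
  have hc0 : 0 ≤ lam * (1 - mu) := mul_nonneg hlam0 (by linarith)
  have hd1 : 1 - lam * mu ≤ 1 := by linarith [mul_nonneg hlam0 hmu0]
  have hz1 : (0 : ℝ) ^ (α + 1) = 0 := zero_rpow (by positivity)
  have hz2 : (0 : ℝ) ^ (α + 2) = 0 := zero_rpow (by positivity)
  have hleft_mid (hc : lam * (1 - mu) ≤ mu) := hleft ε2 δ3
    (by rw [integral_abs_sub_mul_rpow_of_mem le_rfl le_rfl hc0 hc, hε2, hε1]; norm_num; ring)
    (by rw [integral_abs_sub_mul_rpow_of_mem le_rfl hα0.le hc0 hc, hδ3, hz1, hz2]; ring)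
  have hleft_ge (hc : mu ≤ lam * (1 - mu)) := hleft ε1 δ1
    (by rw [integral_abs_sub_mul_rpow_of_le le_rfl hmu0 le_rfl hc, hε1]; norm_num; ring)
    (by rw [integral_abs_sub_mul_rpow_of_le le_rfl hmu0 hα0.le hc, hδ1, hz1, hz2]; ring)
  have hright_mid (hd : mu ≤ 1 - lam * mu) := hright ε3 β1
    (by rw [integral_abs_sub_mul_rpow_of_mem hmu0 le_rfl hd hd1, hε3]; norm_num; ring)
    (by rw [integral_abs_sub_mul_rpow_of_mem hmu0 hα0.le hd hd1, hβ1, one_rpow, one_rpow]; ring)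
  have hright_le (hd : 1 - lam * mu ≤ mu) := hright ε4 β3
    (by rw [integral_abs_sub_mul_rpow_of_ge hmu0 hmu1 le_rfl hd, hε4]; norm_num; ring)
    (by rw [integral_abs_sub_mul_rpow_of_ge hmu0 hmu1 hα0.le hd, hβ3, one_rpow, one_rpow]; ring)
  have hδ2' : δ2 = ε1 - δ1 := by rw [hδ2, hε1]; ring
  have hδ4' : δ4 = ε2 - δ3 := by rw [hδ4, hε2, hε1]; ring
  have hβ2' : β2 = ε3 - β1 := by rw [hβ2, hε3]
  have hβ4' : β4 = ε4 - β3 := by rw [hβ4, hε4]; ring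
  have hmul : 0 ≤ m * b - a := by linarith
  rw [hδ2', hδ4', hβ2', hβ4']
  exact ⟨fun hc => hEle.trans (mul_le_mul_of_nonneg_left
      (add_le_add (hleft_mid hc.1) (hright_mid hc.2)) hmul),
    fun hc => hEle.trans (mul_le_mul_of_nonneg_left
      (add_le_add (hleft_ge hc.1) (hright_mid (hc.1.trans hc.2))) hmul),
    fun hc => hEle.trans (mul_le_mul_of_nonneg_left
      (add_le_add (hleft_mid (hc.1.trans hc.2)) (hright_le hc.2)) hmul)⟩
end

section
/- Let f : I ⊆ [0,∞) → ℝ be differentiable on I° with f' integrable on [a,b], where a,b ∈ I° with a < b, let λ, μ ∈ [0,1], and suppose |f'| is (α,m)-convex on [a,b] for some (α,m) ∈ (0,1]² with mb > a. With δ₁ = λ(1−μ)μ^{α+1}/(α+1) − μ^{α+2}/(α+2), δ₂ = λ(1−μ)μ − μ²/2 − δ₁, δ₃ = 2(λ(1−μ))^{α+2}/((α+1)(α+2)) − λ(1−μ)μ^{α+1}/(α+1) + μ^{α+2}/(α+2), δ₄ = (λ(1−μ))² − λμ(1−μ) + μ²/2 − δ₃, β₁ = 2(1−λμ)^{α+2}/((α+1)(α+2))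 − (1−λμ)(1+μ^{α+1})/(α+1) + (1+μ^{α+2})/(α+2), β₂ = (1−λμ)² − (1−λμ)(1+μ) + (1+μ²)/2 − β₁, β₃ = (1−μ^{α+2})/(α+2) − (1−λμ)(1−μ^{α+1})/(α+1), β₄ = (1−λμ)(μ−1) + (1−μ²)/2 − β₃, and writing E = |λ(μ f(a) + (1−μ) f(mb)) + (1−λ) f(μa + m(1−μ)b) − (1/(mb−a)) ∫ₐ^{mb} f(x) dx|: if λ(1−μ) ≤ μ ≤ 1−λμ then E ≤ (mb−a)[(δ₃+β₁)|f'(a)| + m(δ₄+β₂)|f'(b)|]; if μ ≤ λ(1−μ) ≤ 1−λμ then E ≤ (mb−a)[(δ₁+β₁)|f'(a)| + m(δ₂+β₂)|f'(b)|]; if λ(1−μ) ≤ 1−λμ ≤ μ then E ≤ (mb−a)[(δ₃+β₃)|f'(a)| + m(δ₄+β₄)|f'(b)|]. -/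
open MeasureTheory Set Real

/-- The antiderivative of `t ↦ (t - c) * t ^ α` that vanishes at `0`. -/
noncomputable def kernelPrimitive (α c t : ℝ) : ℝ :=
  t ^ (α + 2) / (α + 2) - c * t ^ (α + 1) / (α + 1)

lemma kernelPrimitive_at_zero {α : ℝ} (hα : 0 ≤ α) (c : ℝ) : kernelPrimitive α c 0 = 0 := by
  rw [kernelPrimitive, zero_rpow (by linarith), zero_rpow (by linarith)]
  simp

lemma kernelPrimitive_at_one (α c : ℝ) :
    kernelPrimitive α c 1 = 1 / (α + 2) - c / (α + 1) := by
  simp [kernelPrimitive]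

lemma kernelPrimitive_self {α c : ℝ} (hα : 0 ≤ α) (hc : 0 ≤ c) :
    kernelPrimitive α c c = -(c ^ (α + 2) / ((α + 1) * (α + 2))) := by
  have h : c ^ (α + 2) = c * c ^ (α + 1) := by
    rw [show α + 2 = 1 + (α + 1) by ring, rpow_add_of_nonneg hc zero_le_one (by linarith),
      rpow_one]
  rw [kernelPrimitive, ← h]
  have h1 : α + 1 ≠ 0 := by linarith
  have h2 : α + 2 ≠ 0 := by linarith
  field_simp
  ring

lemma kernelPrimitive_exponent_zero (c t : ℝ) : kernelPrimitive 0 c t = t ^ 2 / 2 - c * t := by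
  simp [kernelPrimitive]

lemma hasDerivAt_kernelPrimitive {α : ℝ} (hα : 0 ≤ α) (c : ℝ) {t : ℝ} (ht : 0 ≤ t) :
    HasDerivAt (kernelPrimitive α c) ((t - c) * t ^ α) t := by
  have h1 := (hasDerivAt_rpow_const (x := t) (p := α + 2) (Or.inr (by linarith))).div_const (α + 2)
  have h2 := ((hasDerivAt_rpow_const (x := t) (p := α + 1)
    (Or.inr (by linarith))).const_mul c).div_const (α + 1)
  refine (h1.sub h2).congr_deriv ?_
  have h : t ^ (α + 1) = t * t ^ α := by
    rw [add_comm, rpow_add_of_nonneg ht zero_le_one hα, rpow_one]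
  rw [show α + 2 - 1 = α + 1 by ring, show α + 1 - 1 = α by ring, h]
  have h1 : α + 1 ≠ 0 := by linarith
  have h2 : α + 2 ≠ 0 := by linarith
  field_simp

lemma integral_sub_mul_rpow_s2 {α : ℝ} (hα : 0 ≤ α) (c : ℝ) {p q : ℝ} (hp : 0 ≤ p) (hq : 0 ≤ q) :
    ∫ t in p..q, (t - c) * t ^ α = kernelPrimitive α c q - kernelPrimitive α c p := by
  refine intervalIntegral.integral_eq_sub_of_hasDerivAt (fun t ht => ?_) ?_
  · exact hasDerivAt_kernelPrimitive hα c ((le_min hp hq).trans ht.1)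
  · exact ((continuous_id.sub continuous_const).mul
      (continuous_rpow_const hα)).intervalIntegrable _ _

lemma integral_abs_sub_mul_rpow_of_le_left {α c p q : ℝ} (hα : 0 ≤ α) (hp : 0 ≤ p) (hpq : p ≤ q)
    (hc : c ≤ p) :
    ∫ t in p..q, |t - c| * t ^ α = kernelPrimitive α c q - kernelPrimitive α c p := by
  rw [← integral_sub_mul_rpow_s2 hα c hp (hp.trans hpq)]
  refine intervalIntegral.integral_congr fun t ht => ?_
  rw [uIcc_of_le hpq] at ht
  simp only [abs_of_nonneg (sub_nonneg.2 (hc.trans ht.1))]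

lemma integral_abs_sub_mul_rpow_of_right_le {α c p q : ℝ} (hα : 0 ≤ α) (hp : 0 ≤ p) (hpq : p ≤ q)
    (hc : q ≤ c) :
    ∫ t in p..q, |t - c| * t ^ α = kernelPrimitive α c p - kernelPrimitive α c q := by
  rw [← neg_sub, ← integral_sub_mul_rpow_s2 hα c hp (hp.trans hpq), ← intervalIntegral.integral_neg]
  refine intervalIntegral.integral_congr fun t ht => ?_
  rw [uIcc_of_le hpq] at ht
  simp only [abs_of_nonpos (sub_nonpos.2 (ht.2.trans hc)), neg_mul]

lemma intervalIntegrable_abs_sub_mul_rpow {α : ℝ} (hα : 0 ≤ α) (c p q : ℝ) :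
    IntervalIntegrable (fun t : ℝ => |t - c| * t ^ α) volume p q :=
  ((continuous_id.sub continuous_const).abs.mul (continuous_rpow_const hα)).intervalIntegrable _ _

lemma integral_abs_sub_mul_rpow_of_mem_s2 {α c p q : ℝ} (hα : 0 ≤ α) (hp : 0 ≤ p) (hpc : p ≤ c)
    (hcq : c ≤ q) :
    ∫ t in p..q, |t - c| * t ^ α =
      kernelPrimitive α c q + kernelPrimitive α c p - 2 * kernelPrimitive α c c := by
  rw [← intervalIntegral.integral_add_adjacent_intervals
    (intervalIntegrable_abs_sub_mul_rpow hα c p c) (intervalIntegrable_abs_sub_mul_rpow hα c c q),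
    integral_abs_sub_mul_rpow_of_right_le hα hp hpc le_rfl,
    integral_abs_sub_mul_rpow_of_le_left hα (hp.trans hpc) hcq le_rfl]
  ring

lemma abs_integral_sub_mul_le {α m A B c p q : ℝ} {g : ℝ → ℝ} (hα : 0 ≤ α) (hpq : p ≤ q)
    (hg : ∀ t ∈ Icc p q, |g t| ≤ t ^ α * A + m * (1 - t ^ α) * B) :
    |∫ t in p..q, (t - c) * g t| ≤ (∫ t in p..q, |t - c| * t ^ α) * A +
      m * ((∫ t in p..q, |t - c| * t ^ (0 : ℝ)) - ∫ t in p..q, |t - c| * t ^ α) * B := by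
  have hi := intervalIntegrable_abs_sub_mul_rpow hα c p q
  have hi0 := intervalIntegrable_abs_sub_mul_rpow le_rfl c p q
  have hbound : IntervalIntegrable (fun t : ℝ => |t - c| * t ^ α * A +
      m * (|t - c| * t ^ (0 : ℝ) - |t - c| * t ^ α) * B) volume p q :=
    (hi.mul_const A).add (((hi0.sub hi).const_mul m).mul_const B)
  calc |∫ t in p..q, (t - c) * g t|
      ≤ ∫ t in p..q, (|t - c| * t ^ α * A +
          m * (|t - c| * t ^ (0 : ℝ) - |t - c| * t ^ α) * B) := by
        rw [← Real.norm_eq_abs]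
        refine intervalIntegral.norm_integral_le_of_norm_le hpq
          (Filter.Eventually.of_forall fun t ht => ?_) hbound
        rw [Real.norm_eq_abs, abs_mul, rpow_zero]
        calc |t - c| * |g t| ≤ |t - c| * (t ^ α * A + m * (1 - t ^ α) * B) :=
              mul_le_mul_of_nonneg_left (hg t (Ioc_subset_Icc_self ht)) (abs_nonneg _)
          _ = _ := by ring
    _ = _ := by
        rw [intervalIntegral.integral_add (hi.mul_const A)
          (((hi0.sub hi).const_mul m).mul_const B), intervalIntegral.integral_mul_const,
          intervalIntegral.integral_mul_const, intervalIntegral.integral_const_mul,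
          intervalIntegral.integral_sub hi0 hi]

lemma integral_sub_mul_deriv_s2 {F F' : ℝ → ℝ} {p q : ℝ} (c : ℝ)
    (hF : ∀ t ∈ uIcc p q, HasDerivAt F (F' t) t) (hF' : IntervalIntegrable F' volume p q) :
    ∫ t in p..q, (t - c) * F' t = (q - c) * F q - (p - c) * F p - ∫ t in p..q, F t := by
  rw [intervalIntegral.integral_mul_deriv_eq_deriv_mul (u := fun t => t - c) (u' := fun _ => 1)
      (fun t _ => (hasDerivAt_id t).sub_const c) hF intervalIntegrable_const hF']
  simp

/-- The error of the weighted three-point rule on `[a, e]`, through Peano kernels. -/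
lemma three_point_error_eq {f f' : ℝ → ℝ} {a e : ℝ} (hae : a < e) (lam : ℝ) {mu : ℝ}
    (hmu : mu ∈ Icc (0 : ℝ) 1) (hf : ∀ x ∈ Icc a e, HasDerivAt f (f' x) x)
    (hint : IntervalIntegrable f' volume a e) :
    lam * (mu * f a + (1 - mu) * f e) + (1 - lam) * f (mu * a + (1 - mu) * e)
        - (1 / (e - a)) * ∫ x in a..e, f x
      = -((e - a) * ((∫ t in (0 : ℝ)..mu, (t - lam * (1 - mu)) * f' (e - (e - a) * t)) +
          ∫ t in mu..1, (t - (1 - lam * mu)) * f' (e - (e - a) * t))) := by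
  have h : 0 < e - a := sub_pos.2 hae
  set F : ℝ → ℝ := fun t => f (e - (e - a) * t) with hFdef
  set F' : ℝ → ℝ := fun t => -(e - a) * f' (e - (e - a) * t) with hF'def
  have hF : ∀ t ∈ Icc (0 : ℝ) 1, HasDerivAt F (F' t) t := by
    intro t ht
    have hx : e - (e - a) * t ∈ Icc a e := ⟨by nlinarith [ht.2], by nlinarith [ht.1]⟩
    have hd : HasDerivAt (fun t : ℝ => e - (e - a) * t) (-(e - a)) t := by
      simpa using ((hasDerivAt_id t).const_mul (e - a)).const_sub e
    exact ((hf _ hx).comp t hd).congr_deriv (by rw [hF'def]; ring)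
  have hF'int : IntervalIntegrable F' volume 0 1 := by
    have h1 := ((hint.comp_sub_left e).comp_mul_left (c := e - a)).symm
    simp only [sub_self, zero_div, div_self h.ne'] at h1
    exact h1.const_mul _
  have hcF : ContinuousOn F (Icc 0 1) := fun t ht => (hF t ht).continuousAt.continuousWithinAt
  have hFint : IntervalIntegrable F volume 0 1 := by
    apply ContinuousOn.intervalIntegrable
    rwa [uIcc_of_le zero_le_one]
  have hs1 : uIcc 0 mu ⊆ Icc (0 : ℝ) 1 := by
    rw [uIcc_of_le hmu.1]; exact Icc_subset_Icc_right hmu.2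
  have hs2 : uIcc mu 1 ⊆ Icc (0 : ℝ) 1 := by
    rw [uIcc_of_le hmu.2]; exact Icc_subset_Icc_left hmu.1
  have hs : uIcc (0 : ℝ) 1 = Icc 0 1 := uIcc_of_le zero_le_one
  have e1 := integral_sub_mul_deriv_s2 (lam * (1 - mu)) (fun t ht => hF t (hs1 ht))
    (hF'int.mono_set (hs ▸ hs1))
  have e2 := integral_sub_mul_deriv_s2 (1 - lam * mu) (fun t ht => hF t (hs2 ht))
    (hF'int.mono_set (hs ▸ hs2))
  have hadd := intervalIntegral.integral_add_adjacent_intervals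
    (hFint.mono_set (hs ▸ hs1)) (hFint.mono_set (hs ▸ hs2))
  have hcv : ∫ t in (0 : ℝ)..1, F t = (1 / (e - a)) * ∫ x in a..e, f x := by
    rw [hFdef, intervalIntegral.integral_comp_sub_mul f h.ne' e]
    simp
  have hpull : ∀ p q c : ℝ, ∫ t in p..q, (t - c) * F' t =
      -((e - a) * ∫ t in p..q, (t - c) * f' (e - (e - a) * t)) := by
    intro p q c
    rw [← neg_mul, ← intervalIntegral.integral_const_mul]
    refine intervalIntegral.integral_congr fun t _ => ?_
    simp only [hF'def]
    ring
  have hF0 : F 0 = f e := by simp [hFdef]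
  have hF1 : F 1 = f a := by simp [hFdef]
  have hFmu : F mu = f (mu * a + (1 - mu) * e) := by
    simp only [hFdef]; congr 1; ring
  rw [hpull, hF0] at e1
  rw [hpull, hF1] at e2
  rw [← hFmu, ← hcv, ← hadd]
  linear_combination -e1 - e2

theorem corollary_q_one (I : Set ℝ) (hI : I.OrdConnected) (hI0 : I ⊆ Ici (0:ℝ))
    (f f' : ℝ → ℝ) (a b lam mu m α : ℝ)
    (ha : a ∈ interior I) (hb : b ∈ interior I) (hab : a < b)
    (hlam : lam ∈ Icc (0:ℝ) 1) (hmu : mu ∈ Icc (0:ℝ) 1)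
    (hα : α ∈ Ioc (0:ℝ) 1) (hm : m ∈ Ioc (0:ℝ) 1) (hmb : a < m * b)
    (hdiff : ∀ x ∈ interior I, HasDerivAt f (f' x) x)
    (hint : IntervalIntegrable f' volume a b)
    (hconv : AlphaMConvexOn (Icc a b) α m (fun x => |f' x|))
    (E δ1 δ2 δ3 δ4 β1 β2 β3 β4 : ℝ)
    (hE : E = |lam * (mu * f a + (1 - mu) * f (m * b))
        + (1 - lam) * f (mu * a + m * (1 - mu) * b)
        - (1 / (m * b - a)) * ∫ x in a..(m * b), f x|)
    (hδ1 : δ1 = lam * (1 - mu) * mu ^ (α + 1) / (α + 1) - mu ^ (α + 2) / (α + 2))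
    (hδ2 : δ2 = lam * (1 - mu) * mu - mu ^ 2 / 2 - δ1)
    (hδ3 : δ3 = 2 * (lam * (1 - mu)) ^ (α + 2) / ((α + 1) * (α + 2))
        - lam * (1 - mu) * mu ^ (α + 1) / (α + 1) + mu ^ (α + 2) / (α + 2))
    (hδ4 : δ4 = (lam * (1 - mu)) ^ 2 - lam * mu * (1 - mu) + mu ^ 2 / 2 - δ3)
    (hβ1 : β1 = 2 * (1 - lam * mu) ^ (α + 2) / ((α + 1) * (α + 2))
        - (1 - lam * mu) * (1 + mu ^ (α + 1)) / (α + 1) + (1 + mu ^ (α + 2)) / (α + 2))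
    (hβ2 : β2 = (1 - lam * mu) ^ 2 - (1 - lam * mu) * (1 + mu) + (1 + mu ^ 2) / 2 - β1)
    (hβ3 : β3 = (1 - mu ^ (α + 2)) / (α + 2) - (1 - lam * mu) * (1 - mu ^ (α + 1)) / (α + 1))
    (hβ4 : β4 = (1 - lam * mu) * (mu - 1) + (1 - mu ^ 2) / 2 - β3) :
    ((lam * (1 - mu) ≤ mu ∧ mu ≤ 1 - lam * mu) →
      E ≤ (m * b - a) * ((δ3 + β1) * |f' a| + m * (δ4 + β2) * |f' b|)) ∧
    ((mu ≤ lam * (1 - mu) ∧ lam * (1 - mu) ≤ 1 - lam * mu) →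
      E ≤ (m * b - a) * ((δ1 + β1) * |f' a| + m * (δ2 + β2) * |f' b|)) ∧
    ((lam * (1 - mu) ≤ 1 - lam * mu ∧ 1 - lam * mu ≤ mu) →
      E ≤ (m * b - a) * ((δ3 + β3) * |f' a| + m * (δ4 + β4) * |f' b|)) := by
  have ha0 : 0 ≤ a := hI0 (interior_subset ha)
  have hmbb : m * b ≤ b := mul_le_of_le_one_left (ha0.trans hab.le) hm.2
  have hsub : Icc a (m * b) ⊆ interior I := fun x hx =>
    hI.interior.out ha hb ⟨hx.1, hx.2.trans hmbb⟩
  have hinta : IntervalIntegrable f' volume a (m * b) := by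
    refine hint.mono_set ?_
    rw [uIcc_of_le hmb.le, uIcc_of_le hab.le]
    exact Icc_subset_Icc_right hmbb
  have key := three_point_error_eq hmb lam hmu (fun x hx => hdiff x (hsub hx)) hinta
  have hg : ∀ t ∈ Icc (0 : ℝ) 1, |f' (m * b - (m * b - a) * t)| ≤
      t ^ α * |f' a| + m * (1 - t ^ α) * |f' b| := by
    intro t ht
    have := hconv a (left_mem_Icc.2 hab.le) b (right_mem_Icc.2 hab.le) t ht
    rwa [show t * a + m * (1 - t) * b = m * b - (m * b - a) * t by ring] at this
  set c := lam * (1 - mu) with hc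
  set d := 1 - lam * mu with hd
  have hh : 0 ≤ m * b - a := sub_nonneg.2 hmb.le
  have hα0 := hα.1.le
  have hc0 : 0 ≤ c := mul_nonneg hlam.1 (sub_nonneg.2 hmu.2)
  have hd1 : d ≤ 1 := by linarith [mul_nonneg hlam.1 hmu.1]
  have hcd : c ≤ d := by linarith [hlam.2]
  have hd0 : 0 ≤ d := hc0.trans hcd
  have b1 := abs_integral_sub_mul_le (c := c) hα0 hmu.1
    fun t ht => hg t ⟨ht.1, ht.2.trans hmu.2⟩
  have b2 := abs_integral_sub_mul_le (c := d) hα0 hmu.2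
    fun t ht => hg t ⟨hmu.1.trans ht.1, ht.2⟩
  have hEle : E ≤ (m * b - a) *
      (((∫ t in (0 : ℝ)..mu, |t - c| * t ^ α) * |f' a| +
        m * ((∫ t in (0 : ℝ)..mu, |t - c| * t ^ (0 : ℝ)) -
          ∫ t in (0 : ℝ)..mu, |t - c| * t ^ α) * |f' b|) +
      ((∫ t in mu..1, |t - d| * t ^ α) * |f' a| +
        m * ((∫ t in mu..1, |t - d| * t ^ (0 : ℝ)) -
          ∫ t in mu..1, |t - d| * t ^ α) * |f' b|)) := by
    rw [hE, show m * (1 - mu) * b = (1 - mu) * (m * b) by ring, key, abs_neg, abs_mul,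
      abs_of_nonneg hh]
    exact mul_le_mul_of_nonneg_left ((abs_add_le _ _).trans (add_le_add b1 b2)) hh
  have left_inside : c ≤ mu → (∫ t in (0 : ℝ)..mu, |t - c| * t ^ α) = δ3 ∧
      (∫ t in (0 : ℝ)..mu, |t - c| * t ^ (0 : ℝ)) = δ3 + δ4 := by
    intro h
    rw [integral_abs_sub_mul_rpow_of_mem_s2 hα0 le_rfl hc0 h,
      integral_abs_sub_mul_rpow_of_mem_s2 le_rfl le_rfl hc0 h, kernelPrimitive_at_zero hα0,
      kernelPrimitive_self hα0 hc0]
    simp only [kernelPrimitive_exponent_zero]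
    refine ⟨by rw [hδ3, kernelPrimitive]; ring, by rw [hδ4, hc]; ring⟩
  have left_outside : mu ≤ c → (∫ t in (0 : ℝ)..mu, |t - c| * t ^ α) = δ1 ∧
      (∫ t in (0 : ℝ)..mu, |t - c| * t ^ (0 : ℝ)) = δ1 + δ2 := by
    intro h
    rw [integral_abs_sub_mul_rpow_of_right_le hα0 le_rfl hmu.1 h,
      integral_abs_sub_mul_rpow_of_right_le le_rfl le_rfl hmu.1 h, kernelPrimitive_at_zero hα0]
    simp only [kernelPrimitive_exponent_zero]
    refine ⟨by rw [hδ1, kernelPrimitive]; ring, by rw [hδ2]; ring⟩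
  have right_inside : mu ≤ d → (∫ t in mu..1, |t - d| * t ^ α) = β1 ∧
      (∫ t in mu..1, |t - d| * t ^ (0 : ℝ)) = β1 + β2 := by
    intro h
    rw [integral_abs_sub_mul_rpow_of_mem_s2 hα0 hmu.1 h hd1,
      integral_abs_sub_mul_rpow_of_mem_s2 le_rfl hmu.1 h hd1, kernelPrimitive_at_one,
      kernelPrimitive_self hα0 hd0]
    simp only [kernelPrimitive_exponent_zero]
    refine ⟨by rw [hβ1, kernelPrimitive]; ring, by rw [hβ2]; ring⟩
  have right_outside : d ≤ mu → (∫ t in mu..1, |t - d| * t ^ α) = β3 ∧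
      (∫ t in mu..1, |t - d| * t ^ (0 : ℝ)) = β3 + β4 := by
    intro h
    rw [integral_abs_sub_mul_rpow_of_le_left hα0 hmu.1 hmu.2 h,
      integral_abs_sub_mul_rpow_of_le_left le_rfl hmu.1 hmu.2 h, kernelPrimitive_at_one]
    simp only [kernelPrimitive_exponent_zero]
    refine ⟨by rw [hβ3, kernelPrimitive]; ring, by rw [hβ4]; ring⟩
  refine ⟨fun h => ?_, fun h => ?_, fun h => ?_⟩
  · rw [(left_inside h.1).1, (left_inside h.1).2, (right_inside h.2).1,
      (right_inside h.2).2] at hEle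
    exact hEle.trans_eq (by ring)
  · have h2 := h.1.trans h.2
    rw [(left_outside h.1).1, (left_outside h.1).2, (right_inside h2).1,
      (right_inside h2).2] at hEle
    exact hEle.trans_eq (by ring)
  · have h1 := h.1.trans h.2
    rw [(left_inside h1).1, (left_inside h1).2, (right_outside h.2).1,
      (right_outside h.2).2] at hEle
    exact hEle.trans_eq (by ring)
end

section
/- Let f : I ⊆ [0,∞) → ℝ be differentiable on I° with f' integrable on [a,b], where a,b ∈ I° with a < b, and suppose |f'| is (1,m)-convex (i.e. m-convex) on [a,b] for some m ∈ (0,1] with mb > a. Then |(1/6)[f(a) + 4f((a+mb)/2) + f(mb)] − (1/(mb−a)) ∫ₐ^{mb} f(x) dx| ≤ (5/72)(mb−a)[|f'(a)| + m|f'(b)|]. -/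
open MeasureTheory Set Real

/-- A kernel estimate: integrating by parts against `x - s` on an interval where `x - s` has
constant sign `σ`, with the derivative bounded by an affine function. -/
theorem abs_by_parts_le_of_abs_deriv_le_affine {f f' : ℝ → ℝ} {u v s σ α β : ℝ} (huv : u ≤ v)
    (hf : ∀ x ∈ Icc u v, HasDerivAt f (f' x) x)
    (hint : IntervalIntegrable f' volume u v)
    (hbound : ∀ x ∈ Icc u v, |f' x| ≤ α + β * x)
    (hsign : ∀ x ∈ Icc u v, |x - s| = σ * (x - s)) :
    |(v - s) * f v - (u - s) * f u - ∫ x in u..v, f x| ≤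
      σ * ((α * (v - s) ^ 2 / 2 + β * (v ^ 3 / 3 - s * v ^ 2 / 2)) -
        (α * (u - s) ^ 2 / 2 + β * (u ^ 3 / 3 - s * u ^ 2 / 2))) := by
  have hparts : ∫ x in u..v, (x - s) * f' x =
      (v - s) * f v - (u - s) * f u - ∫ x in u..v, f x := by
    have h := intervalIntegral.integral_mul_deriv_eq_deriv_mul
      (u := fun x : ℝ => x - s) (u' := fun _ => (1 : ℝ)) (v := f) (v' := f') (a := u) (b := v)
      (fun x _ => (hasDerivAt_id x).sub_const s)
      (fun x hx => hf x (by rwa [uIcc_of_le huv] at hx))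
      (by simp) hint
    simpa using h
  have hpoly : ∫ x in u..v, σ * ((x - s) * (α + β * x)) =
      σ * ((α * (v - s) ^ 2 / 2 + β * (v ^ 3 / 3 - s * v ^ 2 / 2)) -
        (α * (u - s) ^ 2 / 2 + β * (u ^ 3 / 3 - s * u ^ 2 / 2))) := by
    rw [intervalIntegral.integral_const_mul]
    congr 1
    refine intervalIntegral.integral_eq_sub_of_hasDerivAt
      (f := fun x => α * (x - s) ^ 2 / 2 + β * (x ^ 3 / 3 - s * x ^ 2 / 2)) (fun x _ => ?_)
      (Continuous.intervalIntegrable (by fun_prop) _ _)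
    have h1 := (((hasDerivAt_id x).sub_const s).pow 2).const_mul α |>.div_const 2
    have h2 := (((hasDerivAt_pow 3 x).div_const 3).sub
      (((hasDerivAt_pow 2 x).const_mul s).div_const 2)).const_mul β
    refine (h1.add h2).congr_deriv ?_
    simp
    ring
  rw [← hparts, ← hpoly, ← Real.norm_eq_abs]
  refine intervalIntegral.norm_integral_le_of_norm_le huv
    (Filter.Eventually.of_forall fun x hx => ?_)
    (Continuous.intervalIntegrable (by fun_prop) _ _)
  have hx' := Ioc_subset_Icc_self hx
  rw [norm_mul, Real.norm_eq_abs, Real.norm_eq_abs, ← mul_assoc, ← hsign x hx']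
  exact mul_le_mul_of_nonneg_left (hbound x hx') (abs_nonneg _)

/-- The Simpson inequality on an interval of length `6 * h` for a function whose derivative is
bounded in absolute value by an affine function. -/
theorem abs_simpson_le_of_abs_deriv_le_affine {f f' : ℝ → ℝ} {a h α β : ℝ} (hh : 0 < h)
    (hf : ∀ x ∈ Icc a (a + 6 * h), HasDerivAt f (f' x) x)
    (hint : IntervalIntegrable f' volume a (a + 6 * h))
    (hbound : ∀ x ∈ Icc a (a + 6 * h), |f' x| ≤ α + β * x) :
    |h * (f a + 4 * f (a + 3 * h) + f (a + 6 * h)) - ∫ x in a..(a + 6 * h), f x| ≤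
      5 * h ^ 2 * (α + β * (a + 3 * h)) := by
  have hcont : ContinuousOn f (Icc a (a + 6 * h)) :=
    fun x hx => (hf x hx).continuousAt.continuousWithinAt
  have hsub : ∀ i j : ℝ, 0 ≤ i → i ≤ j → j ≤ 6 →
      Icc (a + i * h) (a + j * h) ⊆ Icc a (a + 6 * h) := fun i j hi _ hj =>
    Icc_subset_Icc (by nlinarith) (by nlinarith)
  have hfint : ∀ i j : ℝ, 0 ≤ i → i ≤ j → j ≤ 6 →
      IntervalIntegrable f volume (a + i * h) (a + j * h) := fun i j hi hij hj =>
    (hcont.mono (hsub i j hi hij hj)).intervalIntegrable_of_Icc (by nlinarith)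
  have hpiece : ∀ i j k σ : ℝ, 0 ≤ i → i ≤ j → j ≤ 6 →
      (∀ x ∈ Icc (a + i * h) (a + j * h), |x - (a + k * h)| = σ * (x - (a + k * h))) → _ :=
    fun i j k σ hi hij hj hs =>
    abs_by_parts_le_of_abs_deriv_le_affine (f := f) (f' := f') (α := α) (β := β)
      (by nlinarith : a + i * h ≤ a + j * h)
      (fun x hx => hf x (hsub i j hi hij hj hx))
      (hint.mono_set (by
        rw [uIcc_of_le (by nlinarith), uIcc_of_le (by nlinarith)]
        exact hsub i j hi hij hj))
      (fun x hx => hbound x (hsub i j hi hij hj hx)) hs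
  have h1 := hpiece 0 1 1 (-1) (by norm_num) (by norm_num) (by norm_num) fun x hx => by
    rw [abs_of_nonpos (by linarith [hx.2])]; ring
  have h2 := hpiece 1 3 1 1 (by norm_num) (by norm_num) (by norm_num) fun x hx => by
    rw [abs_of_nonneg (by linarith [hx.1])]; ring
  have h3 := hpiece 3 5 5 (-1) (by norm_num) (by norm_num) (by norm_num) fun x hx => by
    rw [abs_of_nonpos (by linarith [hx.2])]; ring
  have h4 := hpiece 5 6 5 1 (by norm_num) (by norm_num) (by norm_num) fun x hx => by
    rw [abs_of_nonneg (by linarith [hx.1])]; ring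
  have i1 := hfint 0 1 (by norm_num) (by norm_num) (by norm_num)
  have i2 := hfint 1 3 (by norm_num) (by norm_num) (by norm_num)
  have i3 := hfint 3 5 (by norm_num) (by norm_num) (by norm_num)
  have i4 := hfint 5 6 (by norm_num) (by norm_num) (by norm_num)
  have e1 := intervalIntegral.integral_add_adjacent_intervals i1 i2
  have e2 := intervalIntegral.integral_add_adjacent_intervals (i1.trans i2) i3
  have e3 := intervalIntegral.integral_add_adjacent_intervals ((i1.trans i2).trans i3) i4
  simp only [zero_mul, add_zero] at h1 e1 e2 e3
  rw [abs_le] at h1 h2 h3 h4 ⊢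
  constructor
  · linarith [h1.1, h2.1, h3.1, h4.1]
  · linarith [h1.2, h2.2, h3.2, h4.2]

theorem simpson_m_convex (I : Set ℝ) (hI : I.OrdConnected) (hI0 : I ⊆ Ici (0:ℝ))
    (f f' : ℝ → ℝ) (a b m : ℝ)
    (ha : a ∈ interior I) (hb : b ∈ interior I) (hab : a < b)
    (hm : m ∈ Ioc (0:ℝ) 1) (hmb : a < m * b)
    (hdiff : ∀ x ∈ interior I, HasDerivAt f (f' x) x)
    (hint : IntervalIntegrable f' volume a b)
    (hconv : AlphaMConvexOn (Icc a b) 1 m (fun x => |f' x|)) :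
    |(1 / 6) * (f a + 4 * f ((a + m * b) / 2) + f (m * b))
        - (1 / (m * b - a)) * ∫ x in a..(m * b), f x|
      ≤ (5 / 72) * (m * b - a) * (|f' a| + m * |f' b|) := by
  have ha0 : 0 ≤ a := hI0 (interior_subset ha)
  have hb0 : 0 < b := ha0.trans_lt hab
  have hmb' : m * b ≤ b := by nlinarith [hm.2]
  have hIcc : Icc a b ⊆ interior I := hI.interior.out ha hb
  obtain ⟨h, hh⟩ : ∃ h, h = (m * b - a) / 6 := ⟨_, rfl⟩
  have hpos : 0 < h := by rw [hh]; linarith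
  have hc : m * b = a + 6 * h := by rw [hh]; ring
  have hsub : Icc a (a + 6 * h) ⊆ Icc a b := Icc_subset_Icc le_rfl (hc ▸ hmb')
  have key := abs_simpson_le_of_abs_deriv_le_affine (f := f) (f' := f')
    (α := |f' a| - (m * |f' b| - |f' a|) / (6 * h) * a)
    (β := (m * |f' b| - |f' a|) / (6 * h)) hpos
    (fun x hx => hdiff x (hIcc (hsub hx)))
    (hint.mono_set (by
      rw [uIcc_of_le (by linarith), uIcc_of_le hab.le]
      exact hsub))
    (fun x hx => by
      have hcx := hconv a (left_mem_Icc.2 hab.le) b (right_mem_Icc.2 hab.le)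
        (1 - (x - a) / (6 * h))
        ⟨sub_nonneg.2 ((div_le_one (by positivity)).2 (by linarith [hx.2])),
          sub_le_self _ (div_nonneg (by linarith [hx.1]) (by positivity))⟩
      have hx' : (1 - (x - a) / (6 * h)) * a + m * (1 - (1 - (x - a) / (6 * h))) * b = x := by
        have : m * (1 - (1 - (x - a) / (6 * h))) * b = (x - a) / (6 * h) * (a + 6 * h) := by
          rw [← hc]; ring
        rw [this]
        field_simp
        ring
      simp only [Real.rpow_one, hx'] at hcx
      refine hcx.trans_eq ?_
      ring)
  have hmid : (a + m * b) / 2 = a + 3 * h := by rw [hc]; ring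
  rw [hmid, hc, show a + 6 * h - a = 6 * h by ring]
  have hlhs : (1 / 6) * (f a + 4 * f (a + 3 * h) + f (a + 6 * h))
      - (1 / (6 * h)) * ∫ x in a..(a + 6 * h), f x =
      (h * (f a + 4 * f (a + 3 * h) + f (a + 6 * h)) - ∫ x in a..(a + 6 * h), f x) / (6 * h) := by
    field_simp
  rw [hlhs, abs_div, abs_of_pos (by positivity : 0 < 6 * h), div_le_iff₀ (by positivity)]
  refine key.trans_eq ?_
  field_simp
  ring
end

section
/- Let f : I ⊆ [0,∞) → ℝ be differentiable on I° with f' integrable on [a,b], where a,b ∈ I° with a < b, and suppose |f'| is (1,m)-convex (i.e. m-convex) on [a,b] for some m ∈ (0,1] with mb > a. Then |(f(a) + f(mb))/2 − (1/(mb−a)) ∫ₐ^{mb} f(x) dx| ≤ ((mb−a)/8)[|f'(a)| + m|f'(b)|]. -/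
open MeasureTheory Set Real

theorem integral_sub_mul_affine (a b z p q : ℝ) :
    ∫ x in a..b, (x - z) * (p + q * (x - z)) =
      (p * (b - z) ^ 2 / 2 + q * (b - z) ^ 3 / 3) -
        (p * (a - z) ^ 2 / 2 + q * (a - z) ^ 3 / 3) := by
  refine intervalIntegral.integral_eq_sub_of_hasDerivAt
    (f := fun x => p * (x - z) ^ 2 / 2 + q * (x - z) ^ 3 / 3) (fun x _ => ?_)
    (Continuous.intervalIntegrable (by fun_prop) _ _)
  have h := (hasDerivAt_id' x).sub_const z
  refine ((((h.pow 2).const_mul p).div_const 2).add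
    (((h.pow 3).const_mul q).div_const 3)).congr_deriv ?_
  norm_num
  ring

/-- Only the value of the affine factor at the midpoint contributes. -/
theorem integral_abs_sub_midpoint_mul_affine {a c : ℝ} (hac : a ≤ c) (p q : ℝ) :
    ∫ x in a..c, |x - (a + c) / 2| * (p + q * (x - (a + c) / 2)) = p * (c - a) ^ 2 / 4 := by
  have hi : ∀ u v : ℝ, IntervalIntegrable
      (fun x => |x - (a + c) / 2| * (p + q * (x - (a + c) / 2))) volume u v :=
    fun u v => Continuous.intervalIntegrable (by fun_prop) _ _
  rw [← intervalIntegral.integral_add_adjacent_intervals (hi a ((a + c) / 2)) (hi _ c)]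
  have h1 : ∫ x in a..((a + c) / 2), |x - (a + c) / 2| * (p + q * (x - (a + c) / 2)) =
      -∫ x in a..((a + c) / 2), (x - (a + c) / 2) * (p + q * (x - (a + c) / 2)) := by
    rw [← intervalIntegral.integral_neg]
    refine intervalIntegral.integral_congr fun x hx => ?_
    rw [uIcc_of_le (by linarith)] at hx
    simp only [abs_of_nonpos (sub_nonpos.2 hx.2), neg_mul]
  have h2 : ∫ x in ((a + c) / 2)..c, |x - (a + c) / 2| * (p + q * (x - (a + c) / 2)) =
      ∫ x in ((a + c) / 2)..c, (x - (a + c) / 2) * (p + q * (x - (a + c) / 2)) := by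
    refine intervalIntegral.integral_congr fun x hx => ?_
    rw [uIcc_of_le (by linarith)] at hx
    simp only [abs_of_nonneg (sub_nonneg.2 hx.1)]
  rw [h1, h2, integral_sub_mul_affine, integral_sub_mul_affine]
  ring

/-- The trapezoid rule error is controlled by an affine bound on the derivative. -/
theorem abs_trapezoid_sub_average_le {f f' : ℝ → ℝ} {a c A B : ℝ} (hac : a < c)
    (hf : ∀ x ∈ Icc a c, HasDerivAt f (f' x) x) (hf' : IntervalIntegrable f' volume a c)
    (hbound : ∀ t ∈ Icc (0 : ℝ) 1, |f' (t * a + (1 - t) * c)| ≤ t * A + (1 - t) * B) :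
    |(f a + f c) / 2 - (1 / (c - a)) * ∫ x in a..c, f x| ≤ (c - a) / 8 * (A + B) := by
  have hpos : 0 < c - a := sub_pos.2 hac
  have hparts : ∫ x in a..c, (x - (a + c) / 2) * f' x =
      (c - a) * ((f a + f c) / 2) - ∫ x in a..c, f x := by
    rw [intervalIntegral.integral_mul_deriv_eq_deriv_mul (u := fun x => x - (a + c) / 2)
      (u' := fun _ => 1) (v := f) (fun x _ => (hasDerivAt_id x).sub_const _)
      (fun x hx => hf x (by rwa [uIcc_of_le hac.le] at hx)) intervalIntegrable_const hf']
    simp only [one_mul]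
    ring
  have hle : |∫ x in a..c, (x - (a + c) / 2) * f' x| ≤ (A + B) / 2 * (c - a) ^ 2 / 4 := by
    rw [← integral_abs_sub_midpoint_mul_affine hac.le _ ((B - A) / (c - a)), ← norm_eq_abs]
    refine intervalIntegral.norm_integral_le_of_norm_le hac.le
      (Filter.Eventually.of_forall fun x hx => ?_)
      (Continuous.intervalIntegrable (by fun_prop) _ _)
    rw [norm_mul, norm_eq_abs, norm_eq_abs]
    refine mul_le_mul_of_nonneg_left ?_ (abs_nonneg _)
    have h := hbound ((c - x) / (c - a))
      ⟨div_nonneg (by linarith [hx.2]) hpos.le, (div_le_one hpos).2 (by linarith [hx.1])⟩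
    have hx' : (c - x) / (c - a) * a + (1 - (c - x) / (c - a)) * c = x := by
      field_simp
      ring
    rw [hx'] at h
    refine h.trans_eq ?_
    field_simp
    ring
  have heq : (f a + f c) / 2 - (1 / (c - a)) * ∫ x in a..c, f x =
      (∫ x in a..c, (x - (a + c) / 2) * f' x) / (c - a) := by
    rw [hparts]
    field_simp
  rw [heq, abs_div, abs_of_pos hpos, div_le_iff₀ hpos]
  refine hle.trans_eq ?_
  ring

theorem trapezoid_m_convex (I : Set ℝ) (hI : I.OrdConnected) (hI0 : I ⊆ Ici (0:ℝ))
    (f f' : ℝ → ℝ) (a b m : ℝ)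
    (ha : a ∈ interior I) (hb : b ∈ interior I) (hab : a < b)
    (hm : m ∈ Ioc (0:ℝ) 1) (hmb : a < m * b)
    (hdiff : ∀ x ∈ interior I, HasDerivAt f (f' x) x)
    (hint : IntervalIntegrable f' volume a b)
    (hconv : AlphaMConvexOn (Icc a b) 1 m (fun x => |f' x|)) :
    |(f a + f (m * b)) / 2 - (1 / (m * b - a)) * ∫ x in a..(m * b), f x|
      ≤ ((m * b - a) / 8) * (|f' a| + m * |f' b|) := by
  have hb0 : 0 ≤ b := hI0 (interior_subset hb)
  have hmb' : m * b ≤ b := mul_le_of_le_one_left hb0 hm.2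
  have hsub : Icc a (m * b) ⊆ interior I :=
    (Icc_subset_Icc_right hmb').trans (hI.interior.out ha hb)
  refine abs_trapezoid_sub_average_le hmb (fun x hx => hdiff x (hsub hx))
    (hint.mono_set ?_) fun t ht => ?_
  · rw [uIcc_of_le hmb.le, uIcc_of_le hab.le]
    exact Icc_subset_Icc_right hmb'
  · have h := hconv a (left_mem_Icc.2 hab.le) b (right_mem_Icc.2 hab.le) t ht
    simp only [rpow_one] at h
    rw [show t * a + (1 - t) * (m * b) = t * a + m * (1 - t) * b by ring]
    linarith
end

section
/- Let f : I ⊆ [0,∞) → ℝ be differentiable on I° with f' integrable on [a,b], where a,b ∈ I° with a < b, and suppose |f'| is (1,m)-convex (i.e. m-convex) on [a,b] for some m ∈ (0,1] with mb > a. Then |f((a+mb)/2) − (1/(mb−a)) ∫ₐ^{mb} f(x) dx| ≤ ((mb−a)/8)[|f'(a)| + m|f'(b)|]. -/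
open MeasureTheory Set Real

/-- If `|f'|` is dominated on `[a, d]` by an affine function, then the increments of `f` are
dominated by those of the quadratic antiderivative. -/
theorem abs_sub_le_of_abs_deriv_le_affine {f f' : ℝ → ℝ} {a d c p k : ℝ}
    (hdiff : ∀ x ∈ Icc a d, HasDerivAt f (f' x) x)
    (hbound : ∀ x ∈ Icc a d, |f' x| ≤ p + k * (x - c))
    {x y : ℝ} (hx : x ∈ Icc a d) (hy : y ∈ Icc a d) (hxy : x ≤ y) :
    |f y - f x| ≤ (p * (y - c) + k / 2 * (y - c) ^ 2) - (p * (x - c) + k / 2 * (x - c) ^ 2) := by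
  have hQ : ∀ z : ℝ, HasDerivAt (fun z => p * (z - c) + k / 2 * (z - c) ^ 2)
      (p + k * (z - c)) z := by
    intro z
    have h := (hasDerivAt_id' z).sub_const c
    refine ((h.const_mul p).add ((h.pow 2).const_mul (k / 2))).congr_deriv ?_
    norm_num
    ring
  have hsub : MonotoneOn (fun z => (p * (z - c) + k / 2 * (z - c) ^ 2) - f z) (Icc a d) := by
    refine monotoneOn_of_hasDerivWithinAt_nonneg (convex_Icc a d)
      (fun z hz => ((hQ z).sub (hdiff z hz)).continuousAt.continuousWithinAt)
      (fun z hz => ((hQ z).sub (hdiff z (interior_subset hz))).hasDerivWithinAt)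
      (fun z hz => ?_)
    linarith [le_abs_self (f' z), hbound z (interior_subset hz)]
  have hadd : MonotoneOn (fun z => (p * (z - c) + k / 2 * (z - c) ^ 2) + f z) (Icc a d) := by
    refine monotoneOn_of_hasDerivWithinAt_nonneg (convex_Icc a d)
      (fun z hz => ((hQ z).add (hdiff z hz)).continuousAt.continuousWithinAt)
      (fun z hz => ((hQ z).add (hdiff z (interior_subset hz))).hasDerivWithinAt)
      (fun z hz => ?_)
    linarith [neg_abs_le (f' z), hbound z (interior_subset hz)]
  have h1 := hsub hx hy hxy
  have h2 := hadd hx hy hxy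
  simp only at h1 h2
  rw [abs_le]
  constructor <;> linarith

theorem integral_linear_add_quadratic (p k c u v : ℝ) :
    ∫ x in u..v, (p * (x - c) + k / 2 * (x - c) ^ 2) =
      (p / 2 * (v - c) ^ 2 + k / 6 * (v - c) ^ 3)
        - (p / 2 * (u - c) ^ 2 + k / 6 * (u - c) ^ 3) := by
  refine intervalIntegral.integral_eq_sub_of_hasDerivAt
    (f := fun x => p / 2 * (x - c) ^ 2 + k / 6 * (x - c) ^ 3) (fun z _ => ?_)
    (Continuous.intervalIntegrable (by fun_prop) _ _)
  have h := (hasDerivAt_id' z).sub_const c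
  refine (((h.pow 2).const_mul (p / 2)).add ((h.pow 3).const_mul (k / 6))).congr_deriv ?_
  norm_num
  ring

/-- The midpoint rule error when `|f'|` is dominated by the affine function with value `p` at the
midpoint and slope `k`. -/
theorem abs_integral_midpoint_sub_le {f f' : ℝ → ℝ} {a d p k : ℝ} (had : a ≤ d)
    (hdiff : ∀ x ∈ Icc a d, HasDerivAt f (f' x) x)
    (hbound : ∀ x ∈ Icc a d, |f' x| ≤ p + k * (x - (a + d) / 2)) :
    |∫ x in a..d, (f x - f ((a + d) / 2))| ≤ p * (d - a) ^ 2 / 4 := by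
  set c := (a + d) / 2 with hc
  have hac : a ≤ c := by linarith
  have hcd : c ≤ d := by linarith
  have hcmem : c ∈ Icc a d := ⟨hac, hcd⟩
  have hcont : ContinuousOn (fun x => f x - f c) (Icc a d) :=
    (fun x hx => ((hdiff x hx).sub_const (f c)).continuousAt.continuousWithinAt)
  have hi1 : IntervalIntegrable (fun x => f x - f c) volume a c :=
    (hcont.mono (by rw [uIcc_of_le hac]; exact Icc_subset_Icc_right hcd)).intervalIntegrable
  have hi2 : IntervalIntegrable (fun x => f x - f c) volume c d :=
    (hcont.mono (by rw [uIcc_of_le hcd]; exact Icc_subset_Icc_left hac)).intervalIntegrable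
  have h1 : |∫ x in a..c, (f x - f c)| ≤
      ∫ x in a..c, -(p * (x - c) + k / 2 * (x - c) ^ 2) := by
    rw [← Real.norm_eq_abs]
    refine intervalIntegral.norm_integral_le_of_norm_le hac (ae_of_all _ fun x hx => ?_)
      (Continuous.intervalIntegrable (by fun_prop) _ _)
    have h := abs_sub_le_of_abs_deriv_le_affine hdiff hbound
      ⟨hx.1.le, hx.2.trans hcd⟩ hcmem hx.2
    rw [Real.norm_eq_abs, abs_sub_comm]
    refine h.trans_eq ?_
    ring
  have h2 : |∫ x in c..d, (f x - f c)| ≤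
      ∫ x in c..d, (p * (x - c) + k / 2 * (x - c) ^ 2) := by
    rw [← Real.norm_eq_abs]
    refine intervalIntegral.norm_integral_le_of_norm_le hcd (ae_of_all _ fun x hx => ?_)
      (Continuous.intervalIntegrable (by fun_prop) _ _)
    have h := abs_sub_le_of_abs_deriv_le_affine hdiff hbound
      hcmem ⟨hac.trans hx.1.le, hx.2⟩ hx.1.le
    rw [Real.norm_eq_abs]
    refine h.trans_eq ?_
    ring
  rw [intervalIntegral.integral_neg, integral_linear_add_quadratic] at h1
  rw [integral_linear_add_quadratic] at h2
  rw [← intervalIntegral.integral_add_adjacent_intervals hi1 hi2]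
  refine (abs_add_le _ _).trans ((add_le_add h1 h2).trans_eq ?_)
  rw [hc]
  ring

theorem AlphaMConvexOn.le_affine {g : ℝ → ℝ} {a b m : ℝ} (hg : AlphaMConvexOn (Icc a b) 1 m g)
    (hab : a ≤ b) (hmb : a < m * b) {x : ℝ} (hx : x ∈ Icc a (m * b)) :
    g x ≤ (g a + m * g b) / 2 + (m * g b - g a) / (m * b - a) * (x - (a + m * b) / 2) := by
  have hL : 0 < m * b - a := sub_pos.2 hmb
  have h := hg a ⟨le_rfl, hab⟩ b ⟨hab, le_rfl⟩ ((m * b - x) / (m * b - a))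
    ⟨div_nonneg (sub_nonneg.2 hx.2) hL.le, (div_le_one hL).2 (by linarith [hx.1])⟩
  have hpoint : (m * b - x) / (m * b - a) * a + m * (1 - (m * b - x) / (m * b - a)) * b = x := by
    field_simp
    ring
  rw [hpoint, Real.rpow_one] at h
  refine h.trans_eq ?_
  field_simp
  ring

theorem midpoint_m_convex (I : Set ℝ) (hI : I.OrdConnected) (hI0 : I ⊆ Ici (0:ℝ))
    (f f' : ℝ → ℝ) (a b m : ℝ)
    (ha : a ∈ interior I) (hb : b ∈ interior I) (hab : a < b)
    (hm : m ∈ Ioc (0:ℝ) 1) (hmb : a < m * b)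
    (hdiff : ∀ x ∈ interior I, HasDerivAt f (f' x) x)
    (hint : IntervalIntegrable f' volume a b)
    (hconv : AlphaMConvexOn (Icc a b) 1 m (fun x => |f' x|)) :
    |f ((a + m * b) / 2) - (1 / (m * b - a)) * ∫ x in a..(m * b), f x|
      ≤ ((m * b - a) / 8) * (|f' a| + m * |f' b|) := by
  have hL : 0 < m * b - a := sub_pos.2 hmb
  have hb0 : 0 ≤ b := hI0 (interior_subset hb)
  have hmb_le : m * b ≤ b := mul_le_of_le_one_left hb0 hm.2
  have hsubset : Icc a (m * b) ⊆ interior I :=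
    (Icc_subset_Icc_right hmb_le).trans (hI.interior.out ha hb)
  have hdiff' : ∀ x ∈ Icc a (m * b), HasDerivAt f (f' x) x := fun x hx => hdiff x (hsubset hx)
  have hfi : IntervalIntegrable f volume a (m * b) := by
    refine ContinuousOn.intervalIntegrable fun x hx => ?_
    rw [uIcc_of_le hmb.le] at hx
    exact (hdiff' x hx).continuousAt.continuousWithinAt
  have h := abs_integral_midpoint_sub_le hmb.le hdiff'
    (fun x hx => hconv.le_affine hab.le hmb hx)
  rw [intervalIntegral.integral_sub hfi intervalIntegrable_const,
    intervalIntegral.integral_const, smul_eq_mul] at h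
  have heq : f ((a + m * b) / 2) - (1 / (m * b - a)) * ∫ x in a..(m * b), f x =
      -((∫ x in a..(m * b), f x) - (m * b - a) * f ((a + m * b) / 2)) / (m * b - a) := by
    field_simp
    ring
  rw [heq, abs_div, abs_neg, abs_of_pos hL, div_le_iff₀ hL]
  refine h.trans_eq ?_
  ring
end

section
/- Let f : I ⊆ [0,∞) → ℝ be differentiable on I° with f' integrable on [a,b], where a,b ∈ I° with a < b, and suppose |f'|^q is convex on [a,b] for some q ≥ 1. Then |(1/6)[f(a) + 4f((a+b)/2) + f(b)] − (1/(b−a)) ∫ₐ^{b} f(x) dx| ≤ (b−a)(5/72)^{1−1/q} [ ((29/1296)|f'(b)|^q + (61/1296)|f'(a)|^q)^{1/q} + ((61/1296)|f'(b)|^q + (29/1296)|f'(a)|^q)^{1/q} ]. -/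
open MeasureTheory Set Real

/-- The first moments of the left half of the Simpson kernel. -/
theorem integral_abs_sub_sixth_mul_affine (α β : ℝ) :
    ∫ t in (0 : ℝ)..(1 / 2), |t - 1 / 6| * (α + β * t) = 5 / 72 * α + 29 / 1296 * β := by
  have hc : Continuous fun t : ℝ => |t - 1 / 6| * (α + β * t) := by fun_prop
  have hd : ∀ t : ℝ, HasDerivAt
      (fun t : ℝ => β / 3 * t ^ 3 + (α - β / 6) / 2 * t ^ 2 - α / 6 * t)
      ((t - 1 / 6) * (α + β * t)) t := by
    intro t
    have h := (((hasDerivAt_pow 3 t).const_mul (β / 3)).add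
      ((hasDerivAt_pow 2 t).const_mul ((α - β / 6) / 2))).sub ((hasDerivAt_id t).const_mul (α / 6))
    refine h.congr_deriv ?_
    norm_num
    ring
  have hp : ∀ u v : ℝ, ∫ t in u..v, (t - 1 / 6) * (α + β * t) =
      (β / 3 * v ^ 3 + (α - β / 6) / 2 * v ^ 2 - α / 6 * v) -
      (β / 3 * u ^ 3 + (α - β / 6) / 2 * u ^ 2 - α / 6 * u) := fun u v =>
    intervalIntegral.integral_eq_sub_of_hasDerivAt (fun t _ => hd t)
      (Continuous.intervalIntegrable (by fun_prop) _ _)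
  rw [← intervalIntegral.integral_add_adjacent_intervals
    (hc.intervalIntegrable 0 (1 / 6)) (hc.intervalIntegrable (1 / 6) (1 / 2))]
  have h₁ : ∫ t in (0 : ℝ)..(1 / 6), |t - 1 / 6| * (α + β * t) =
      ∫ t in (0 : ℝ)..(1 / 6), -((t - 1 / 6) * (α + β * t)) := by
    refine intervalIntegral.integral_congr fun t ht => ?_
    rw [uIcc_of_le (by norm_num)] at ht
    rw [abs_of_nonpos (by linarith [ht.2])]
    ring
  have h₂ : ∫ t in (1 / 6 : ℝ)..(1 / 2), |t - 1 / 6| * (α + β * t) =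
      ∫ t in (1 / 6 : ℝ)..(1 / 2), (t - 1 / 6) * (α + β * t) := by
    refine intervalIntegral.integral_congr fun t ht => ?_
    rw [uIcc_of_le (by norm_num)] at ht
    rw [abs_of_nonneg (by linarith [ht.1])]
  rw [h₁, h₂, intervalIntegral.integral_neg, hp, hp]
  ring

/-- Concavity of `x ↦ x ^ r` for `0 ≤ r ≤ 1`, as a tangent line inequality. -/
theorem rpow_le_tangent {r x y : ℝ} (hr0 : 0 ≤ r) (hr1 : r ≤ 1) (hx : 0 ≤ x) (hy : 0 < y) :
    x ^ r ≤ y ^ r * (1 + r * (x / y - 1)) := by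
  have h := rpow_one_add_le_one_add_mul_self (s := x / y - 1)
    (by linarith [div_nonneg hx hy.le]) hr0 hr1
  rw [add_sub_cancel, div_rpow hx hy.le, div_le_iff₀ (rpow_pos_of_pos hy r)] at h
  linarith

/-- The weighted power mean estimate for the left half of the Simpson kernel. -/
theorem abs_integral_sub_sixth_mul_le {h : ℝ → ℝ} {A B r : ℝ} (hA : 0 ≤ A) (hB : 0 ≤ B)
    (hr0 : 0 < r) (hr1 : r ≤ 1)
    (hh : ∀ t ∈ Icc (0 : ℝ) (1 / 2), |h t| ≤ ((1 - t) * A + t * B) ^ r) :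
    |∫ t in (0 : ℝ)..(1 / 2), (t - 1 / 6) * h t| ≤
      (5 / 72 : ℝ) ^ (1 - r) * (29 / 1296 * B + 61 / 1296 * A) ^ r := by
  obtain ⟨Z, hZ⟩ : ∃ Z, Z = 29 / 1296 * B + 61 / 1296 * A := ⟨_, rfl⟩
  rw [← hZ]
  rcases (show 0 ≤ Z by rw [hZ]; positivity).eq_or_lt with h0 | hpos
  · have hA0 : A = 0 := by linarith
    have hB0 : B = 0 := by linarith
    have hz : ∫ t in (0 : ℝ)..(1 / 2), (t - 1 / 6) * h t = ∫ t in (0 : ℝ)..(1 / 2), (0 : ℝ) := by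
      refine intervalIntegral.integral_congr fun t ht => ?_
      rw [uIcc_of_le (by norm_num)] at ht
      have := hh t ht
      rw [hA0, hB0, mul_zero, mul_zero, add_zero, zero_rpow hr0.ne'] at this
      simp [abs_nonpos_iff.1 this]
    rw [hz, ← h0, zero_rpow hr0.ne']
    simp
  · obtain ⟨Y, hY⟩ : ∃ Y, Y = Z / (5 / 72) := ⟨_, rfl⟩
    have hYpos : 0 < Y := by rw [hY]; positivity
    have hle := intervalIntegral.norm_integral_le_of_norm_le (μ := volume)
      (f := fun t => (t - 1 / 6) * h t)
      (g := fun t => |t - 1 / 6| *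
        (Y ^ r * (1 + r * (A / Y - 1)) + Y ^ r * (r * ((B - A) / Y)) * t))
      (a := 0) (b := 1 / 2) (by norm_num)
      (Filter.Eventually.of_forall fun t ht => by
        rw [norm_eq_abs, abs_mul]
        refine mul_le_mul_of_nonneg_left ?_ (abs_nonneg _)
        have ht1 : 0 ≤ 1 - t := by linarith [ht.2]
        have ht0 : 0 ≤ t := ht.1.le
        refine (hh t ⟨ht0, ht.2⟩).trans
          ((rpow_le_tangent hr0.le hr1 (by positivity) hYpos).trans_eq ?_)
        ring)
      (Continuous.intervalIntegrable (by fun_prop) _ _)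
    rw [integral_abs_sub_sixth_mul_affine] at hle
    refine hle.trans_eq ?_
    have hYr : Y ^ r = Z ^ r / (5 / 72) ^ r := by rw [hY, div_rpow hpos.le (by norm_num)]
    have hW : (5 / 72 : ℝ) ^ (1 - r) = 5 / 72 / (5 / 72) ^ r := by
      rw [rpow_sub (by norm_num), rpow_one]
    have hmean : 5 / 72 * A + 29 / 1296 * (B - A) = 5 / 72 * Y := by
      rw [hY, hZ]; ring
    calc 5 / 72 * (Y ^ r * (1 + r * (A / Y - 1))) + 29 / 1296 * (Y ^ r * (r * ((B - A) / Y)))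
        = Y ^ r * (5 / 72 * (1 - r) + r * ((5 / 72 * A + 29 / 1296 * (B - A)) / Y)) := by ring
      _ = Y ^ r * (5 / 72) := by
          rw [hmean, mul_div_assoc, div_self hYpos.ne']; ring
      _ = (5 / 72) ^ (1 - r) * Z ^ r := by rw [hYr, hW]; ring

/-- The error of Simpson's rule on `[0, 1]` in terms of the derivative. -/
theorem simpson_error_eq_integral {g g' : ℝ → ℝ}
    (hg : ∀ t ∈ Icc (0 : ℝ) 1, HasDerivAt g (g' t) t)
    (hint : IntervalIntegrable g' volume 0 1) :
    1 / 6 * (g 0 + 4 * g (1 / 2) + g 1) - ∫ t in (0 : ℝ)..1, g t =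
      (∫ t in (0 : ℝ)..(1 / 2), (t - 1 / 6) * g' t) +
        ∫ t in (0 : ℝ)..(1 / 2), (1 / 6 - t) * g' (1 - t) := by
  have hsub₁ : uIcc (0 : ℝ) (1 / 2) ⊆ uIcc 0 1 := by
    rw [uIcc_of_le (by norm_num), uIcc_of_le (by norm_num)]
    exact Icc_subset_Icc le_rfl (by norm_num)
  have hsub₂ : uIcc (1 / 2 : ℝ) 1 ⊆ uIcc 0 1 := by
    rw [uIcc_of_le (by norm_num), uIcc_of_le (by norm_num)]
    exact Icc_subset_Icc (by norm_num) le_rfl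
  rw [← uIcc_of_le zero_le_one] at hg
  have hcont : ContinuousOn g (uIcc 0 1) := fun t ht => (hg t ht).continuousAt.continuousWithinAt
  have hparts : ∀ u v c : ℝ, uIcc u v ⊆ uIcc 0 1 →
      ∫ t in u..v, (t - c) * g' t = (v - c) * g v - (u - c) * g u - ∫ t in u..v, g t := by
    intro u v c huv
    have := intervalIntegral.integral_mul_deriv_eq_deriv_mul (u := fun t => t - c) (v := g)
      (u' := fun _ => 1) (v' := g') (a := u) (b := v)
      (fun t _ => (hasDerivAt_id t).sub_const c) (fun t ht => hg t (huv ht))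
      intervalIntegrable_const (hint.mono_set huv)
    simpa using this
  have hreflect : ∫ t in (0 : ℝ)..(1 / 2), (1 / 6 - t) * g' (1 - t) =
      ∫ t in (1 / 2 : ℝ)..1, (t - 5 / 6) * g' t := by
    have := intervalIntegral.integral_comp_sub_left (a := 0) (b := 1 / 2)
      (fun t => (t - 5 / 6) * g' t) 1
    rw [show (1 : ℝ) - 1 / 2 = 1 / 2 by norm_num, sub_zero] at this
    rw [← this]
    refine intervalIntegral.integral_congr fun t _ => ?_
    ring
  rw [hreflect, hparts _ _ _ hsub₁, hparts _ _ _ hsub₂,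
    ← intervalIntegral.integral_add_adjacent_intervals
      (hcont.mono hsub₁).intervalIntegrable (hcont.mono hsub₂).intervalIntegrable]
  ring

theorem simpson_convex_power_mean (I : Set ℝ) (hI : I.OrdConnected) (hI0 : I ⊆ Ici (0:ℝ))
    (f f' : ℝ → ℝ) (a b q : ℝ)
    (ha : a ∈ interior I) (hb : b ∈ interior I) (hab : a < b) (hq : 1 ≤ q)
    (hdiff : ∀ x ∈ interior I, HasDerivAt f (f' x) x)
    (hint : IntervalIntegrable f' volume a b)
    (hconv : ConvexOn ℝ (Icc a b) (fun x => |f' x| ^ q)) :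
    |(1 / 6) * (f a + 4 * f ((a + b) / 2) + f b)
        - (1 / (b - a)) * ∫ x in a..b, f x|
      ≤ (b - a) * (5 / 72 : ℝ) ^ (1 - 1 / q) *
        (((29 / 1296) * |f' b| ^ q + (61 / 1296) * |f' a| ^ q) ^ (1 / q)
          + ((61 / 1296) * |f' b| ^ q + (29 / 1296) * |f' a| ^ q) ^ (1 / q)) := by
  have hq0 : 0 < q := by linarith
  have hr0 : 0 < 1 / q := by positivity
  have hr1 : 1 / q ≤ 1 := (div_le_one hq0).2 hq
  have hba : 0 < b - a := sub_pos.2 hab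
  have hsub : Icc a b ⊆ interior I := hI.interior.out ha hb
  have hmem : ∀ t ∈ Icc (0 : ℝ) 1, (b - a) * t + a ∈ Icc a b := fun t ht =>
    ⟨by nlinarith [ht.1], by nlinarith [ht.2]⟩
  have hbound : ∀ t ∈ Icc (0 : ℝ) 1,
      |f' ((b - a) * t + a)| ≤ ((1 - t) * |f' a| ^ q + t * |f' b| ^ q) ^ (1 / q) := by
    intro t ht
    have h := hconv.2 (left_mem_Icc.2 hab.le) (right_mem_Icc.2 hab.le)
      (sub_nonneg.2 ht.2) ht.1 (sub_add_cancel 1 t)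
    simp only [smul_eq_mul] at h
    rw [show (1 - t) * a + t * b = (b - a) * t + a by ring] at h
    have h' := rpow_le_rpow (by positivity) h hr0.le
    rwa [one_div, rpow_rpow_inv (abs_nonneg _) hq0.ne', ← one_div] at h'
  have hderiv : ∀ t ∈ Icc (0 : ℝ) 1, HasDerivAt (fun t => f ((b - a) * t + a))
      ((b - a) * f' ((b - a) * t + a)) t := by
    intro t ht
    have h₁ : HasDerivAt (fun t : ℝ => (b - a) * t + a) (b - a) t := by
      simpa using ((hasDerivAt_id t).const_mul (b - a)).add_const a
    have h₂ := (hdiff _ (hsub (hmem t ht))).comp t h₁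
    rwa [mul_comm] at h₂
  have hint' : IntervalIntegrable (fun t => (b - a) * f' ((b - a) * t + a)) volume 0 1 := by
    have h := (hint.comp_add_right a).comp_mul_left (c := b - a)
    rw [sub_self, zero_div, div_self hba.ne'] at h
    exact h.const_mul _
  have key := simpson_error_eq_integral hderiv hint'
  have hmid : (b - a) * (1 / 2) + a = (a + b) / 2 := by ring
  have hscale : ∀ (w : ℝ → ℝ) (k : ℝ → ℝ), ∫ t in (0 : ℝ)..(1 / 2), w t * ((b - a) * k t) =
      (b - a) * ∫ t in (0 : ℝ)..(1 / 2), w t * k t := by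
    intro w k
    rw [← intervalIntegral.integral_const_mul]
    exact intervalIntegral.integral_congr fun t _ => by ring
  have hsubst := intervalIntegral.integral_comp_mul_add (a := 0) (b := 1) f hba.ne' a
  rw [hsubst, hscale, hscale (fun t => 1 / 6 - t) (fun t => f' ((b - a) * (1 - t) + a))] at key
  simp only [mul_zero, zero_add, mul_one, sub_add_cancel, hmid, smul_eq_mul] at key
  rw [one_div (b - a), key, ← mul_add, abs_mul, abs_of_pos hba, mul_assoc]
  refine mul_le_mul_of_nonneg_left ((abs_add_le _ _).trans ?_) hba.le
  rw [mul_add]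
  refine add_le_add ?_ ?_
  · exact abs_integral_sub_sixth_mul_le (by positivity) (by positivity) hr0 hr1
      fun t ht => hbound t ⟨ht.1, by linarith [ht.2]⟩
  · have h := abs_integral_sub_sixth_mul_le (h := fun t => -f' ((b - a) * (1 - t) + a))
      (A := |f' b| ^ q) (B := |f' a| ^ q) (by positivity) (by positivity) hr0 hr1 fun t ht => by
        rw [abs_neg]
        refine (hbound (1 - t) ⟨by linarith [ht.2], by linarith [ht.1]⟩).trans_eq ?_
        rw [sub_sub_cancel, add_comm]
    rw [add_comm (29 / 1296 * |f' a| ^ q)] at h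
    refine le_of_eq_of_le (congrArg _ (intervalIntegral.integral_congr fun t _ => ?_)) h
    ring
end

section
/- Let f : I ⊆ [0,∞) → ℝ be differentiable on I° with f' integrable on [a,b], where a,b ∈ I° with a < b, and suppose |f'|^q is (α,m)-convex on [a,b] for (α,m) ∈ (0,1]² with mb > a and q ≥ 1. Then |(f(a)+f(mb))/2 − (1/(mb−a)) ∫ₐ^{mb} f(x) dx| ≤ (mb−a)(1/8)^{1−1/q} [ ( (1/(2^{α+2}(α+1)(α+2)))|f'(a)|^q + m(1/8 − 1/(2^{α+2}(α+1)(α+2)))|f'(b)|^q )^{1/q} + ( ((α·2^{α+1}+1)/(2^{α+2}(α+1)(α+2)))|f'(a)|^q + m(1/8 − (α·2^{α+1}+1)/(2^{α+2}(α+1)(α+2)))|f'(b)|^q )^{1/q} ]. -/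
open MeasureTheory Set Real

/-- Jensen's inequality for `x ↦ x ^ p`, `0 ≤ p ≤ 1`, with a continuous weight. -/
theorem integral_mul_rpow_le {w h : ℝ → ℝ} {u v p : ℝ} (huv : u ≤ v) (hp0 : 0 ≤ p) (hp1 : p ≤ 1)
    (hw : Continuous w) (hh : Continuous h) (hw0 : ∀ x ∈ Icc u v, 0 ≤ w x)
    (hh0 : ∀ x ∈ Icc u v, 0 ≤ h x) (hW : 0 < ∫ x in u..v, w x) :
    ∫ x in u..v, w x * h x ^ p ≤ (∫ x in u..v, w x) ^ (1 - p) * (∫ x in u..v, w x * h x) ^ p := by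
  set W := ∫ x in u..v, w x with hWdef
  set S := ∫ x in u..v, w x * h x with hSdef
  have hS : 0 ≤ S := intervalIntegral.integral_nonneg huv fun x hx =>
    mul_nonneg (hw0 x hx) (hh0 x hx)
  have key : ∀ K, S / W < K → ∫ x in u..v, w x * h x ^ p ≤ W * K ^ p := by
    intro K hK
    have hK0 : 0 < K := (div_nonneg hS hW.le).trans_lt hK
    have hSK : S ≤ K * W := ((div_lt_iff₀ hW).1 hK).le
    have hint : ∫ x in u..v, K ^ p * ((1 - p) * w x + p / K * (w x * h x))
        = K ^ p * ((1 - p) * W + p / K * S) := by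
      rw [intervalIntegral.integral_const_mul, intervalIntegral.integral_add,
        intervalIntegral.integral_const_mul, intervalIntegral.integral_const_mul]
      · exact (hw.const_mul _).intervalIntegrable _ _
      · exact ((hw.mul hh).const_mul _).intervalIntegrable _ _
    calc ∫ x in u..v, w x * h x ^ p
        ≤ ∫ x in u..v, K ^ p * ((1 - p) * w x + p / K * (w x * h x)) := by
          refine intervalIntegral.integral_mono_on huv
            ((hw.mul (hh.rpow_const fun _ => Or.inr hp0)).intervalIntegrable _ _)
            (Continuous.intervalIntegrable (by fun_prop) _ _) fun x hx => ?_
          have hs : -1 ≤ h x / K - 1 := by linarith [div_nonneg (hh0 x hx) hK0.le]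
          have hb := rpow_one_add_le_one_add_mul_self hs hp0 hp1
          rw [add_sub_cancel, div_rpow (hh0 x hx) hK0.le, div_le_iff₀ (rpow_pos_of_pos hK0 p)] at hb
          calc w x * h x ^ p ≤ w x * ((1 + p * (h x / K - 1)) * K ^ p) :=
                mul_le_mul_of_nonneg_left hb (hw0 x hx)
            _ = _ := by ring
      _ = K ^ p * ((1 - p) * W + p / K * S) := hint
      _ ≤ K ^ p * ((1 - p) * W + p / K * (K * W)) := by gcongr
      _ = W * K ^ p := by field_simp; ring
  have hlim : Filter.Tendsto (fun K : ℝ => W * K ^ p) (nhdsWithin (S / W) (Ioi (S / W)))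
      (nhds (W * (S / W) ^ p)) :=
    ((continuous_const.mul
      (continuous_id.rpow_const fun _ => Or.inr hp0)).tendsto (S / W)).mono_left nhdsWithin_le_nhds
  have hle := ge_of_tendsto hlim (eventually_mem_nhdsWithin.mono key)
  refine hle.trans_eq ?_
  rw [div_rpow hS hW.le, rpow_sub hW, rpow_one]
  ring

theorem integral_sub_half_mul_rpow {α u v : ℝ} (hα : 0 < α) (hu : 0 ≤ u) (huv : u ≤ v) :
    ∫ t in u..v, (t - 1 / 2) * t ^ α
      = (v ^ (α + 2) - u ^ (α + 2)) / (α + 2) - (v ^ (α + 1) - u ^ (α + 1)) / (2 * (α + 1)) := by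
  have hcongr : ∫ t in u..v, (t - 1 / 2) * t ^ α = ∫ t in u..v, (t ^ (α + 1) - 1 / 2 * t ^ α) := by
    refine intervalIntegral.integral_congr fun t ht => ?_
    rw [uIcc_of_le huv] at ht
    have h0 : 0 ≤ t := hu.trans ht.1
    simp only [rpow_add_one' h0 (by linarith : α + 1 ≠ 0)]
    ring
  rw [hcongr, intervalIntegral.integral_sub
      (intervalIntegral.intervalIntegrable_rpow' (by linarith))
      ((intervalIntegral.intervalIntegrable_rpow' (by linarith)).const_mul _),
    intervalIntegral.integral_const_mul, integral_rpow (Or.inl (by linarith)),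
    integral_rpow (Or.inl (by linarith)), add_assoc, one_add_one_eq_two]
  field_simp

theorem integral_sub_half {u v : ℝ} :
    ∫ t in u..v, (t - 1 / 2) = (v ^ 2 - u ^ 2) / 2 - (v - u) / 2 := by
  simp
  ring

theorem integral_half_sub_mul_rpow_left {α : ℝ} (hα : 0 < α) :
    ∫ t in (0 : ℝ)..(1 / 2), (1 / 2 - t) * t ^ α = 1 / (2 ^ (α + 2) * (α + 1) * (α + 2)) := by
  have h := integral_sub_half_mul_rpow hα le_rfl (by norm_num : (0 : ℝ) ≤ 1 / 2)
  have hneg : ∫ t in (0 : ℝ)..(1 / 2), (1 / 2 - t) * t ^ α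
      = -∫ t in (0 : ℝ)..(1 / 2), (t - 1 / 2) * t ^ α := by
    rw [← intervalIntegral.integral_neg]
    congr 1 with t
    ring
  rw [hneg, h, zero_rpow (by linarith), zero_rpow (by linarith), one_div,
    inv_rpow zero_le_two, inv_rpow zero_le_two,
    show α + 2 = α + 1 + 1 by ring, rpow_add_one two_ne_zero (α + 1)]
  have : (0 : ℝ) < 2 ^ (α + 1) := by positivity
  field_simp
  ring

theorem integral_sub_half_mul_rpow_right {α : ℝ} (hα : 0 < α) :
    ∫ t in (1 / 2 : ℝ)..1, (t - 1 / 2) * t ^ α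
      = (α * 2 ^ (α + 1) + 1) / (2 ^ (α + 2) * (α + 1) * (α + 2)) := by
  rw [integral_sub_half_mul_rpow hα (by norm_num) (by norm_num), one_rpow, one_rpow, one_div,
    inv_rpow zero_le_two, inv_rpow zero_le_two,
    show α + 2 = α + 1 + 1 by ring, rpow_add_one two_ne_zero (α + 1)]
  have : (0 : ℝ) < 2 ^ (α + 1) := by positivity
  field_simp
  ring

theorem integral_mul_rpow_combination {w : ℝ → ℝ} (hw : Continuous w) {α : ℝ} (hα : 0 < α)
    (u v m A B : ℝ) :
    ∫ t in u..v, w t * (t ^ α * A + m * (1 - t ^ α) * B)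
      = (∫ t in u..v, w t * t ^ α) * A
        + m * ((∫ t in u..v, w t) - ∫ t in u..v, w t * t ^ α) * B := by
  have hr : Continuous fun t : ℝ => t ^ α := continuous_id.rpow_const fun _ => Or.inr hα.le
  have hi : IntervalIntegrable (fun t => w t * t ^ α) volume u v :=
    (hw.mul hr).intervalIntegrable _ _
  have hwi : IntervalIntegrable w volume u v := hw.intervalIntegrable _ _
  calc ∫ t in u..v, w t * (t ^ α * A + m * (1 - t ^ α) * B)
      = ∫ t in u..v, (A - m * B) * (w t * t ^ α) + (m * B) * w t := by
        congr 1 with t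
        ring
    _ = _ := by
        rw [intervalIntegral.integral_add (hi.const_mul _) (hwi.const_mul _),
          intervalIntegral.integral_const_mul, intervalIntegral.integral_const_mul]
        ring

/-- The trapezoid error, as a first moment of the derivative. -/
theorem trapezoid_error_eq {f f' : ℝ → ℝ} {a c : ℝ} (hac : a < c)
    (hdiff : ∀ x ∈ Icc a c, HasDerivAt f (f' x) x) (hint : IntervalIntegrable f' volume a c) :
    (f a + f c) / 2 - (1 / (c - a)) * ∫ x in a..c, f x
      = (1 / (c - a)) * ∫ x in a..c, (x - (a + c) / 2) * f' x := by
  have h := intervalIntegral.integral_mul_deriv_eq_deriv_mul (a := a) (b := c)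
    (u := fun x => x - (a + c) / 2) (u' := fun _ => 1) (v := f) (v' := f')
    (fun x _ => (hasDerivAt_id x).sub_const _)
    (fun x hx => hdiff x (by rwa [uIcc_of_le hac.le] at hx))
    intervalIntegrable_const hint
  rw [h]
  have : c - a ≠ 0 := sub_ne_zero.2 hac.ne'
  simp only [one_mul]
  field_simp
  ring

/-- A pointwise bound on the derivative, in the barycentric coordinate `(c - x) / (c - a)`,
bounds the trapezoid error. -/
theorem abs_trapezoid_error_le {f f' : ℝ → ℝ} {a c : ℝ} (hac : a < c)
    (hdiff : ∀ x ∈ Icc a c, HasDerivAt f (f' x) x) (hint : IntervalIntegrable f' volume a c)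
    {G : ℝ → ℝ} (hG : Continuous G)
    (hbound : ∀ t ∈ Icc (0 : ℝ) 1, |f' (t * a + (1 - t) * c)| ≤ G t) :
    |(f a + f c) / 2 - (1 / (c - a)) * ∫ x in a..c, f x|
      ≤ (c - a) * ((∫ t in (0 : ℝ)..(1 / 2), (1 / 2 - t) * G t)
        + ∫ t in (1 / 2 : ℝ)..1, (t - 1 / 2) * G t) := by
  have hd : 0 < c - a := sub_pos.2 hac
  have hcont : Continuous fun t : ℝ => |1 / 2 - t| * G t := by fun_prop
  have hle : |∫ x in a..c, (x - (a + c) / 2) * f' x|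
      ≤ ∫ x in a..c, (c - a) * (|1 / 2 - (c / (c - a) - x / (c - a))|
          * G (c / (c - a) - x / (c - a))) := by
    have hcont' : Continuous fun x : ℝ => (c - a) * (|1 / 2 - (c / (c - a) - x / (c - a))|
        * G (c / (c - a) - x / (c - a))) := by fun_prop
    rw [← norm_eq_abs (∫ x in a..c, (x - (a + c) / 2) * f' x)]
    refine intervalIntegral.norm_integral_le_of_norm_le hac.le
      (Filter.Eventually.of_forall fun x hx => ?_) (hcont'.intervalIntegrable _ _)
    have ht : c / (c - a) - x / (c - a) ∈ Icc (0 : ℝ) 1 := by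
      rw [← sub_div]
      exact ⟨div_nonneg (by linarith [hx.2]) hd.le, (div_le_one hd).2 (by linarith [hx.1])⟩
    have hx' : (c / (c - a) - x / (c - a)) * a + (1 - (c / (c - a) - x / (c - a))) * c = x := by
      field_simp
      ring
    have hb := hbound _ ht
    rw [hx'] at hb
    have hmid : x - (a + c) / 2 = (c - a) * (1 / 2 - (c / (c - a) - x / (c - a))) := by
      field_simp
      ring
    rw [norm_mul, norm_eq_abs, norm_eq_abs, hmid, abs_mul, abs_of_pos hd, mul_assoc]
    gcongr
  rw [intervalIntegral.integral_const_mul,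
    intervalIntegral.integral_comp_sub_div (fun t => |1 / 2 - t| * G t) hd.ne', ← sub_div, ← sub_div,
    div_self hd.ne', sub_self, zero_div,
    ← intervalIntegral.integral_add_adjacent_intervals (b := 1 / 2)
      (hcont.intervalIntegrable _ _) (hcont.intervalIntegrable _ _), smul_eq_mul] at hle
  have hl : ∫ t in (0 : ℝ)..(1 / 2), |1 / 2 - t| * G t
      = ∫ t in (0 : ℝ)..(1 / 2), (1 / 2 - t) * G t := by
    refine intervalIntegral.integral_congr fun t ht => ?_
    rw [uIcc_of_le (by norm_num)] at ht
    simp only [abs_of_nonneg (sub_nonneg.2 ht.2)]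
  have hr : ∫ t in (1 / 2 : ℝ)..1, |1 / 2 - t| * G t
      = ∫ t in (1 / 2 : ℝ)..1, (t - 1 / 2) * G t := by
    refine intervalIntegral.integral_congr fun t ht => ?_
    rw [uIcc_of_le (by norm_num)] at ht
    simp only [abs_sub_comm (1 / 2) t, abs_of_nonneg (sub_nonneg.2 ht.1)]
  rw [hl, hr] at hle
  rw [trapezoid_error_eq hac hdiff hint, abs_mul, abs_of_pos (one_div_pos.2 hd), one_div_mul_eq_div,
    div_le_iff₀ hd]
  linarith

theorem trapezoid_power_mean (I : Set ℝ) (hI : I.OrdConnected) (hI0 : I ⊆ Ici (0:ℝ))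
    (f f' : ℝ → ℝ) (a b m α q : ℝ)
    (ha : a ∈ interior I) (hb : b ∈ interior I) (hab : a < b)
    (hα : α ∈ Ioc (0:ℝ) 1) (hm : m ∈ Ioc (0:ℝ) 1) (hmb : a < m * b) (hq : 1 ≤ q)
    (hdiff : ∀ x ∈ interior I, HasDerivAt f (f' x) x)
    (hint : IntervalIntegrable f' volume a b)
    (hconv : AlphaMConvexOn (Icc a b) α m (fun x => |f' x| ^ q)) :
    |(f a + f (m * b)) / 2 - (1 / (m * b - a)) * ∫ x in a..(m * b), f x|
      ≤ (m * b - a) * (1 / 8 : ℝ) ^ (1 - 1 / q) *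
        (((1 / (2 ^ (α + 2) * (α + 1) * (α + 2))) * |f' a| ^ q
            + m * (1 / 8 - 1 / (2 ^ (α + 2) * (α + 1) * (α + 2))) * |f' b| ^ q) ^ (1 / q)
          + (((α * 2 ^ (α + 1) + 1) / (2 ^ (α + 2) * (α + 1) * (α + 2))) * |f' a| ^ q
            + m * (1 / 8 - (α * 2 ^ (α + 1) + 1) / (2 ^ (α + 2) * (α + 1) * (α + 2)))
              * |f' b| ^ q) ^ (1 / q)) := by
  obtain ⟨hα0, -⟩ := hα
  obtain ⟨hm0, hm1⟩ := hm
  have ha0 : 0 ≤ a := hI0 (interior_subset ha)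
  have hmb' : m * b ≤ b := mul_le_of_le_one_left (ha0.trans hab.le) hm1
  have hq0 : 0 < q := one_pos.trans_le hq
  have hp0 : 0 ≤ 1 / q := (one_div_pos.2 hq0).le
  have hp1 : 1 / q ≤ 1 := (div_le_one hq0).2 hq
  have hsub : Icc a (m * b) ⊆ interior I :=
    (Icc_subset_Icc_right hmb').trans (hI.interior.out ha hb)
  have hint' : IntervalIntegrable f' volume a (m * b) := hint.mono_set (by
    rw [uIcc_of_le hmb.le, uIcc_of_le hab.le]
    exact Icc_subset_Icc_right hmb')
  set A := |f' a| ^ q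
  set B := |f' b| ^ q
  have hA : 0 ≤ A := rpow_nonneg (abs_nonneg _) _
  have hB : 0 ≤ B := rpow_nonneg (abs_nonneg _) _
  set h : ℝ → ℝ := fun t => t ^ α * A + m * (1 - t ^ α) * B with hh
  have hr : Continuous fun t : ℝ => t ^ α := continuous_id.rpow_const fun _ => Or.inr hα0.le
  have hcont : Continuous h := by fun_prop
  have hh0 : ∀ t ∈ Icc (0 : ℝ) 1, 0 ≤ h t := fun t ht => by
    have h1 : t ^ α ≤ 1 := rpow_le_one ht.1 ht.2 hα0.le
    have h2 : 0 ≤ t ^ α := rpow_nonneg ht.1 _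
    exact add_nonneg (mul_nonneg h2 hA) (mul_nonneg (mul_nonneg hm0.le (sub_nonneg.2 h1)) hB)
  have hbound : ∀ t ∈ Icc (0 : ℝ) 1, |f' (t * a + (1 - t) * (m * b))| ≤ h t ^ (1 / q) := by
    intro t ht
    have hc := hconv a (left_mem_Icc.2 hab.le) b (right_mem_Icc.2 hab.le) t ht
    rw [show t * a + m * (1 - t) * b = t * a + (1 - t) * (m * b) by ring] at hc
    rw [one_div, le_rpow_inv_iff_of_pos (abs_nonneg _) (hh0 t ht) hq0]
    exact hc
  have hWl : ∫ t in (0 : ℝ)..(1 / 2), (1 / 2 - t) = 1 / 8 := by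
    have hneg := intervalIntegral.integral_neg (f := fun t : ℝ => t - 1 / 2) (a := 0) (b := 1 / 2)
      (μ := volume)
    simp only [neg_sub] at hneg
    rw [hneg, integral_sub_half]
    norm_num
  have hWr : ∫ t in (1 / 2 : ℝ)..1, (t - 1 / 2) = 1 / 8 := by
    rw [integral_sub_half]
    norm_num
  have hl := integral_mul_rpow_le (w := fun t => 1 / 2 - t) (u := 0) (v := 1 / 2) (by norm_num)
    hp0 hp1 (by fun_prop) hcont (fun t ht => sub_nonneg.2 ht.2)
    (fun t ht => hh0 t ⟨ht.1, ht.2.trans (by norm_num)⟩) (by rw [hWl]; norm_num)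
  have hrt := integral_mul_rpow_le (w := fun t => t - 1 / 2) (u := 1 / 2) (v := 1) (by norm_num)
    hp0 hp1 (by fun_prop) hcont (fun t ht => sub_nonneg.2 ht.1)
    (fun t ht => hh0 t ⟨le_trans (by norm_num) ht.1, ht.2⟩) (by rw [hWr]; norm_num)
  rw [hWl, hh, integral_mul_rpow_combination (by fun_prop) hα0, hWl,
    integral_half_sub_mul_rpow_left hα0] at hl
  rw [hWr, hh, integral_mul_rpow_combination (by fun_prop) hα0, hWr,
    integral_sub_half_mul_rpow_right hα0] at hrt
  refine (abs_trapezoid_error_le hmb (fun x hx => hdiff x (hsub hx)) hint'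
    (hcont.rpow_const fun _ => Or.inr hp0) hbound).trans ?_
  rw [mul_assoc (m * b - a), mul_add ((1 / 8 : ℝ) ^ (1 - 1 / q))]
  exact mul_le_mul_of_nonneg_left (add_le_add hl hrt) (sub_pos.2 hmb).le
end

section
/- Let f : I ⊆ [0,∞) → ℝ be differentiable on I° with f' integrable on [a,b], where a,b ∈ I° with a < b, and suppose |f'|^q is (α,m)-convex on [a,b] for (α,m) ∈ (0,1]² with mb > a, where q > 1 and 1/p + 1/q = 1. Define A₁ = min{ (|f'((a+mb)/2)|^q + αm|f'(b)|^q)/(α+1), (|f'(mb)|^q + αm|f'((a+mb)/(2m))|^q)/(α+1) } and B₁ = min{ (|f'((a+mb)/2)|^q + αm|f'(a/m)|^q)/(α+1), (|f'(a)|^q + αm|f'((a+mb)/(2m))|^q)/(α+1) }. Then |(1/6)[f(a) + 4f((a+mb)/2) + f(mb)] − (1/(mb−a)) ∫ₐ^{mb} f(x) dx| ≤ ((mb−a)/12)((2^{p+1}+1)/(3(p+1)))^{1/p} (A₁^{1/q} + B₁^{1/q}). -/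
open MeasureTheory Set Real

/-- The mean of `t ↦ t ^ α * P + (1 - t ^ α) * Q` over `[0, 1]`. -/
lemma integral_rpow_mul_add_one_sub_rpow_mul {α : ℝ} (hα : 0 < α) (P Q : ℝ) :
    ∫ t in (0:ℝ)..1, (t ^ α * P + (1 - t ^ α) * Q) = (P + α * Q) / (α + 1) := by
  have hi : IntervalIntegrable (fun t : ℝ => t ^ α) volume 0 1 :=
    intervalIntegral.intervalIntegrable_rpow' (by linarith)
  have h1 : ∫ t in (0:ℝ)..1, t ^ α = 1 / (α + 1) := by
    rw [integral_rpow (Or.inl (by linarith)), one_rpow, zero_rpow (by linarith), sub_zero]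
  have hne : α + 1 ≠ 0 := by linarith
  rw [intervalIntegral.integral_add (hi.mul_const _)
      (((intervalIntegrable_const (c := (1:ℝ))).sub hi).mul_const _),
    intervalIntegral.integral_mul_const, intervalIntegral.integral_mul_const,
    intervalIntegral.integral_sub intervalIntegrable_const hi, h1]
  simp
  field_simp
  ring

lemma exists_eq_convex_comb_of_mem_uIcc {u v x : ℝ} (hx : x ∈ uIcc u v) :
    ∃ t ∈ Icc (0:ℝ) 1, x = t * u + (1 - t) * v := by
  rw [← segment_eq_uIcc] at hx
  obtain ⟨s, r, hs, hr, hsr, rfl⟩ := hx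
  refine ⟨s, ⟨hs, by linarith⟩, ?_⟩
  simp only [smul_eq_mul]
  rw [← hsr]
  ring

lemma intervalIntegrable_abs_rpow_of_le {g : ℝ → ℝ} {u v α q P Q : ℝ} (hα : 0 < α)
    (hP : 0 ≤ P) (hQ : 0 ≤ Q) (hg : IntervalIntegrable g volume u v)
    (hle : ∀ t ∈ Icc (0:ℝ) 1, |g (t * u + (1 - t) * v)| ^ q ≤ t ^ α * P + (1 - t ^ α) * Q) :
    IntervalIntegrable (fun x => |g x| ^ q) volume u v := by
  have hmeas : AEStronglyMeasurable (fun x => |g x| ^ q) (volume.restrict (uIoc u v)) :=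
    (hg.def'.aestronglyMeasurable.aemeasurable.norm.pow_const q).aestronglyMeasurable
  refine (intervalIntegrable_const (c := P + Q)).mono_fun hmeas ?_
  filter_upwards [ae_restrict_mem measurableSet_uIoc] with x hx
  obtain ⟨t, ht, rfl⟩ := exists_eq_convex_comb_of_mem_uIcc (uIoc_subset_uIcc hx)
  rw [norm_of_nonneg (by positivity), norm_of_nonneg (by positivity)]
  have h0 := rpow_nonneg ht.1 α
  have h1 := rpow_le_one ht.1 ht.2 hα.le
  nlinarith [hle t ht]

/-- `u` and `v` may come in either order, so the average over an interval can be
bounded from either end. -/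
lemma inv_mul_integral_abs_rpow_le {g : ℝ → ℝ} {u v α q P Q : ℝ} (huv : u ≠ v) (hα : 0 < α)
    (hi : IntervalIntegrable (fun x => |g x| ^ q) volume u v)
    (hle : ∀ t ∈ Icc (0:ℝ) 1, |g (t * u + (1 - t) * v)| ^ q ≤ t ^ α * P + (1 - t ^ α) * Q) :
    (v - u)⁻¹ * ∫ x in u..v, |g x| ^ q ≤ (P + α * Q) / (α + 1) := by
  have hne : u - v ≠ 0 := sub_ne_zero.2 huv
  have hcomb (t : ℝ) : t * u + (1 - t) * v = (u - v) * t + v := by ring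
  have hsub : ∫ t in (0:ℝ)..1, |g (t * u + (1 - t) * v)| ^ q
      = (v - u)⁻¹ * ∫ x in u..v, |g x| ^ q := by
    simp only [hcomb]
    rw [intervalIntegral.integral_comp_mul_add (fun x => |g x| ^ q) hne v,
      intervalIntegral.integral_symm]
    simp only [mul_zero, zero_add, mul_one, sub_add_cancel, smul_eq_mul]
    rw [← neg_sub u v, inv_neg]
    ring
  have hcomp : IntervalIntegrable (fun t => |g (t * u + (1 - t) * v)| ^ q) volume 0 1 := by
    have h := (hi.symm.comp_add_right v).comp_mul_left (c := u - v)
    simp only [hcomb]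
    simpa [hne] using h
  have hi' : IntervalIntegrable (fun t : ℝ => t ^ α) volume 0 1 :=
    intervalIntegral.intervalIntegrable_rpow' (by linarith)
  rw [← hsub, ← integral_rpow_mul_add_one_sub_rpow_mul hα]
  exact intervalIntegral.integral_mono_on zero_le_one hcomp
    ((hi'.mul_const _).add (((intervalIntegrable_const (c := (1:ℝ))).sub hi').mul_const _)) hle

lemma integral_abs_sub_rpow {u v k p : ℝ} (hp : 0 < p) (hk : k ∈ Icc u v) :
    ∫ x in u..v, |x - k| ^ p = ((k - u) ^ (p + 1) + (v - k) ^ (p + 1)) / (p + 1) := by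
  have hc : Continuous fun x : ℝ => |x - k| ^ p :=
    (by fun_prop : Continuous fun x : ℝ => |x - k|).rpow_const fun _ => Or.inr hp.le
  have hl : ∫ x in u..k, |x - k| ^ p = (k - u) ^ (p + 1) / (p + 1) := by
    have : ∫ x in u..k, |x - k| ^ p = ∫ x in u..k, (k - x) ^ p := by
      refine intervalIntegral.integral_congr fun x hx => ?_
      rw [uIcc_of_le hk.1] at hx
      simp only [abs_sub_comm x k, abs_of_nonneg (sub_nonneg.2 hx.2)]
    rw [this, intervalIntegral.integral_comp_sub_left (fun x => x ^ p) k, sub_self,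
      integral_rpow (Or.inl (by linarith)), zero_rpow (by linarith), sub_zero]
  have hr : ∫ x in k..v, |x - k| ^ p = (v - k) ^ (p + 1) / (p + 1) := by
    have : ∫ x in k..v, |x - k| ^ p = ∫ x in k..v, (x - k) ^ p := by
      refine intervalIntegral.integral_congr fun x hx => ?_
      rw [uIcc_of_le hk.2] at hx
      simp only [abs_of_nonneg (sub_nonneg.2 hx.1)]
    rw [this, intervalIntegral.integral_comp_sub_right (fun x => x ^ p) k, sub_self,
      integral_rpow (Or.inl (by linarith)), zero_rpow (by linarith), sub_zero]
  rw [← intervalIntegral.integral_add_adjacent_intervals (hc.intervalIntegrable u k)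
    (hc.intervalIntegrable k v), hl, hr, add_div]

lemma abs_integral_sub_mul_le_s11 {g : ℝ → ℝ} {u v k p q A : ℝ} (hpq : p.HolderConjugate q)
    (huv : u < v) (hk : k ∈ Icc u v) (hg : IntervalIntegrable g volume u v)
    (hgq : IntervalIntegrable (fun x => |g x| ^ q) volume u v)
    (hA : (v - u)⁻¹ * ∫ x in u..v, |g x| ^ q ≤ A) :
    |∫ x in u..v, (x - k) * g x| ≤
      (((k - u) ^ (p + 1) + (v - k) ^ (p + 1)) / (p + 1)) ^ (1 / p) *
        ((v - u) * A) ^ (1 / q) := by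
  have hp := hpq.pos
  have hq := hpq.symm.pos
  have hc : Continuous fun x : ℝ => |x - k| ^ p :=
    (by fun_prop : Continuous fun x : ℝ => |x - k|).rpow_const fun _ => Or.inr hp.le
  have memLp_of {h : ℝ → ℝ} {r : ℝ} (hr : 0 < r)
      (hm : AEStronglyMeasurable h (volume.restrict (Ioc u v)))
      (hi : IntervalIntegrable (fun x => |h x| ^ r) volume u v) :
      MemLp (fun x => |h x|) (ENNReal.ofReal r) (volume.restrict (Ioc u v)) := by
    refine (integrable_norm_rpow_iff hm.norm (by simpa using hr) ENNReal.ofReal_ne_top).1 ?_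
    rw [intervalIntegrable_iff_integrableOn_Ioc_of_le huv.le, IntegrableOn] at hi
    simpa [ENNReal.toReal_ofReal hr.le] using hi
  have hgm : AEStronglyMeasurable g (volume.restrict (Ioc u v)) := hg.1.aestronglyMeasurable
  have holder := integral_mul_le_Lp_mul_Lq_of_nonneg (μ := volume.restrict (Ioc u v)) hpq
    (Filter.Eventually.of_forall fun x => abs_nonneg (x - k))
    (Filter.Eventually.of_forall fun x => abs_nonneg (g x))
    (memLp_of hp (by fun_prop) (hc.intervalIntegrable u v)) (memLp_of hq hgm hgq)
  simp only [← intervalIntegral.integral_of_le huv.le] at holder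
  rw [integral_abs_sub_rpow hp hk] at holder
  have hmean : ∫ x in u..v, |g x| ^ q ≤ (v - u) * A := by
    rwa [inv_mul_le_iff₀ (sub_pos.2 huv)] at hA
  have hnonneg : 0 ≤ ∫ x in u..v, |g x| ^ q :=
    intervalIntegral.integral_nonneg huv.le fun x _ => by positivity
  have h1 := sub_nonneg.2 hk.1
  have h2 := sub_nonneg.2 hk.2
  calc |∫ x in u..v, (x - k) * g x| ≤ ∫ x in u..v, |(x - k) * g x| :=
        intervalIntegral.abs_integral_le_integral_abs huv.le
    _ = ∫ x in u..v, |x - k| * |g x| := by simp only [abs_mul]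
    _ ≤ _ := holder
    _ ≤ _ := by gcongr

lemma integral_sub_mul_deriv_s11 {f f' : ℝ → ℝ} {u v : ℝ} (k : ℝ)
    (hf : ∀ x ∈ uIcc u v, HasDerivAt f (f' x) x) (hf' : IntervalIntegrable f' volume u v) :
    ∫ x in u..v, (x - k) * f' x = (v - k) * f v - (u - k) * f u - ∫ x in u..v, f x := by
  simpa using intervalIntegral.integral_mul_deriv_eq_deriv_mul
    (fun x _ => (hasDerivAt_id x).sub_const k) hf intervalIntegrable_const hf'

lemma simpson_constant_eq {p q L A : ℝ} (hpq : p.HolderConjugate q) (hL : 0 < L) (hA : 0 ≤ A) :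
    (((L / 6) ^ (p + 1) + (L / 3) ^ (p + 1)) / (p + 1)) ^ (1 / p) * (L / 2 * A) ^ (1 / q) =
      L * (L / 12 * ((2 ^ (p + 1) + 1) / (3 * (p + 1))) ^ (1 / p) * A ^ (1 / q)) := by
  have hp := hpq.pos
  have hsum : 1 / p + 1 / q = 1 := by simpa using hpq.inv_add_inv_eq_one
  have hbase : ((L / 6) ^ (p + 1) + (L / 3) ^ (p + 1)) / (p + 1) =
      (L / 6) ^ p * ((L / 2) * ((2 ^ (p + 1) + 1) / (3 * (p + 1)))) := by
    rw [show L / 3 = L / 6 * 2 by ring, mul_rpow (by positivity) (by norm_num),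
      rpow_add_one (by positivity : L / 6 ≠ 0)]
    field_simp
    ring
  have hpow : (L / 2) ^ (1 / p) * (L / 2) ^ (1 / q) = L / 2 := by
    rw [← rpow_add (by positivity), hsum, rpow_one]
  rw [hbase, mul_rpow (by positivity) (by positivity), mul_rpow (by positivity) (by positivity),
    mul_rpow (by positivity) hA, ← rpow_mul (by positivity), mul_one_div_cancel hp.ne', rpow_one]
  linear_combination (L / 6 * ((2 ^ (p + 1) + 1) / (3 * (p + 1))) ^ (1 / p) * A ^ (1 / q)) * hpow

theorem simpson_holder (I : Set ℝ) (hI : I.OrdConnected) (hI0 : I ⊆ Ici (0:ℝ))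
    (f f' : ℝ → ℝ) (a b m α p q : ℝ)
    (ha : a ∈ interior I) (hb : b ∈ interior I) (hab : a < b)
    (hα : α ∈ Ioc (0:ℝ) 1) (hm : m ∈ Ioc (0:ℝ) 1) (hmb : a < m * b)
    (hq : 1 < q) (hpq : 1 / p + 1 / q = 1)
    (hdiff : ∀ x ∈ interior I, HasDerivAt f (f' x) x)
    (hint : IntervalIntegrable f' volume a b)
    (hconv : AlphaMConvexOn (Icc a b) α m (fun x => |f' x| ^ q))
    (A1 B1 : ℝ)
    (hA1 : A1 = min
        ((|f' ((a + m * b) / 2)| ^ q + α * m * |f' b| ^ q) / (α + 1))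
        ((|f' (m * b)| ^ q + α * m * |f' ((a + m * b) / (2 * m))| ^ q) / (α + 1)))
    (hB1 : B1 = min
        ((|f' ((a + m * b) / 2)| ^ q + α * m * |f' (a / m)| ^ q) / (α + 1))
        ((|f' a| ^ q + α * m * |f' ((a + m * b) / (2 * m))| ^ q) / (α + 1))) :
    |(1 / 6) * (f a + 4 * f ((a + m * b) / 2) + f (m * b))
        - (1 / (m * b - a)) * ∫ x in a..(m * b), f x|
      ≤ ((m * b - a) / 12) * ((2 ^ (p + 1) + 1) / (3 * (p + 1))) ^ (1 / p) *
        (A1 ^ (1 / q) + B1 ^ (1 / q)) := by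
  obtain ⟨hα0, -⟩ := hα
  obtain ⟨hm0, hm1⟩ := hm
  have hholder : p.HolderConjugate q := by
    refine (holderConjugate_iff.2 ⟨hq, ?_⟩).symm
    simpa [add_comm] using hpq
  have ha0 : 0 ≤ a := hI0 (interior_subset ha)
  have hb0 : 0 < b := ha0.trans_lt hab
  have hmbb : m * b ≤ b := mul_le_of_le_one_left hb0.le hm1
  set c := (a + m * b) / 2 with hc
  have hac : a < c := by linarith
  have hcd : c < m * b := by linarith
  have hcm : (a + m * b) / (2 * m) = c / m := by rw [hc]; field_simp
  rw [hcm] at hA1 hB1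
  have hdiv {x : ℝ} (hax : a ≤ x) (hx : x ≤ m * b) : x / m ∈ Icc a b :=
    ⟨(le_div_iff₀ hm0).2 (by nlinarith), (div_le_iff₀ hm0).2 (by linarith)⟩
  have hconv' {x y : ℝ} (hx : x ∈ Icc a b) (hax : a ≤ y) (hy : y ≤ m * b) :
      ∀ t ∈ Icc (0:ℝ) 1, |f' (t * x + (1 - t) * y)| ^ q ≤
        t ^ α * |f' x| ^ q + (1 - t ^ α) * (m * |f' (y / m)| ^ q) := by
    intro t ht
    have h := hconv x hx (y / m) (hdiv hax hy) t ht
    have hy' : m * (1 - t) * (y / m) = (1 - t) * y := by field_simp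
    simp only [hy'] at h
    linarith
  have hsub {u v : ℝ} (hu : u ∈ Icc a b) (hv : v ∈ Icc a b) : uIcc u v ⊆ Icc a b :=
    ordConnected_Icc.uIcc_subset hu hv
  have hint' {u v : ℝ} (hu : u ∈ Icc a b) (hv : v ∈ Icc a b) :
      IntervalIntegrable f' volume u v :=
    hint.mono_set (by rw [uIcc_of_le hab.le]; exact hsub hu hv)
  have hderiv {u v : ℝ} (hu : u ∈ Icc a b) (hv : v ∈ Icc a b) :
      ∀ x ∈ uIcc u v, HasDerivAt f (f' x) x := fun x hx =>
    hdiff x (hI.interior.out ha hb (hsub hu hv hx))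
  have hmean {u v : ℝ} (hu : u ∈ Icc a (m * b)) (hv : v ∈ Icc a (m * b)) (huv : u ≠ v) :
      IntervalIntegrable (fun x => |f' x| ^ q) volume u v ∧
      (v - u)⁻¹ * ∫ x in u..v, |f' x| ^ q ≤
        (|f' u| ^ q + α * m * |f' (v / m)| ^ q) / (α + 1) := by
    have hu' : u ∈ Icc a b := ⟨hu.1, hu.2.trans hmbb⟩
    have hv' : v ∈ Icc a b := ⟨hv.1, hv.2.trans hmbb⟩
    have hle := hconv' hu' hv.1 hv.2
    have hi := intervalIntegrable_abs_rpow_of_le hα0 (by positivity) (by positivity)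
      (hint' hu' hv') hle
    refine ⟨hi, (inv_mul_integral_abs_rpow_le huv hα0 hi hle).trans_eq ?_⟩
    ring
  have hswap (u v : ℝ) : (v - u)⁻¹ * ∫ x in u..v, |f' x| ^ q =
      (u - v)⁻¹ * ∫ x in v..u, |f' x| ^ q := by
    rw [intervalIntegral.integral_symm, ← neg_sub u v, inv_neg]
    ring
  have hal : a ∈ Icc a (m * b) := ⟨le_rfl, hmb.le⟩
  have hcl : c ∈ Icc a (m * b) := ⟨hac.le, hcd.le⟩
  have hdl : m * b ∈ Icc a (m * b) := ⟨hmb.le, le_rfl⟩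
  have hinc : Icc a (m * b) ⊆ Icc a b := Icc_subset_Icc_right hmbb
  have hmb' : m * b / m = b := by field_simp
  have hA : (m * b - c)⁻¹ * ∫ x in c..(m * b), |f' x| ^ q ≤ A1 := by
    rw [hA1]
    refine le_min ?_ ?_
    · simpa only [hmb'] using (hmean hcl hdl hcd.ne).2
    · rw [hswap]
      exact (hmean hdl hcl hcd.ne').2
  have hB : (c - a)⁻¹ * ∫ x in a..c, |f' x| ^ q ≤ B1 := by
    rw [hB1]
    refine le_min ?_ (hmean hal hcl hac.ne).2
    rw [hswap]
    exact (hmean hcl hal hac.ne').2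
  have hA0 : 0 ≤ A1 := by rw [hA1]; positivity
  have hB0 : 0 ≤ B1 := by rw [hB1]; positivity
  set L := m * b - a with hL
  have hLpos : 0 < L := sub_pos.2 hmb
  have hleft := abs_integral_sub_mul_le_s11 (k := a + L / 6) hholder hac
    ⟨by linarith, by linarith⟩ (hint' (hinc hal) (hinc hcl)) (hmean hal hcl hac.ne).1 hB
  have hright := abs_integral_sub_mul_le_s11 (k := m * b - L / 6) hholder hcd
    ⟨by linarith, by linarith⟩ (hint' (hinc hcl) (hinc hdl)) (hmean hcl hdl hcd.ne).1 hA
  rw [show a + L / 6 - a = L / 6 by ring, show c - (a + L / 6) = L / 3 by rw [hc, hL]; ring,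
    show c - a = L / 2 by rw [hc, hL]; ring, simpson_constant_eq hholder hLpos hB0] at hleft
  rw [show m * b - L / 6 - c = L / 3 by rw [hc, hL]; ring,
    show m * b - (m * b - L / 6) = L / 6 by ring, show m * b - c = L / 2 by rw [hc, hL]; ring,
    add_comm ((L / 3) ^ (p + 1)), simpson_constant_eq hholder hLpos hA0] at hright
  have hfi {u v : ℝ} (hu : u ∈ Icc a b) (hv : v ∈ Icc a b) : IntervalIntegrable f volume u v :=
    ContinuousOn.intervalIntegrable fun x hx =>
      (hderiv hu hv x hx).continuousAt.continuousWithinAt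
  have key : (1 / 6) * (f a + 4 * f c + f (m * b)) - (1 / L) * ∫ x in a..(m * b), f x =
      (1 / L) * ((∫ x in a..c, (x - (a + L / 6)) * f' x) +
        ∫ x in c..(m * b), (x - (m * b - L / 6)) * f' x) := by
    rw [integral_sub_mul_deriv_s11 _ (hderiv (hinc hal) (hinc hcl)) (hint' (hinc hal) (hinc hcl)),
      integral_sub_mul_deriv_s11 _ (hderiv (hinc hcl) (hinc hdl)) (hint' (hinc hcl) (hinc hdl)),
      ← intervalIntegral.integral_add_adjacent_intervals (hfi (hinc hal) (hinc hcl))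
        (hfi (hinc hcl) (hinc hdl)),
      show c - (a + L / 6) = L / 3 by rw [hc, hL]; ring,
      show c - (m * b - L / 6) = -(L / 3) by rw [hc, hL]; ring]
    field_simp
    ring
  rw [key, abs_mul, abs_of_pos (one_div_pos.2 hLpos), one_div_mul_eq_div, div_le_iff₀ hLpos]
  refine (abs_add_le _ _).trans ((add_le_add hleft hright).trans_eq ?_)
  ring
end

section
/- Let f : I ⊆ [0,∞) → ℝ be differentiable on I° with f' integrable on [a,b], where a,b ∈ I° with a < b, and suppose |f'|^q is (α,m)-convex on [a,b] for (α,m) ∈ (0,1]² with mb > a, where q > 1 and 1/p + 1/q = 1. With A₁ = min{ (|f'((a+mb)/2)|^q + αm|f'(b)|^q)/(α+1), (|f'(mb)|^q + αm|f'((a+mb)/(2m))|^q)/(α+1) } and B₁ = min{ (|f'((a+mb)/2)|^q + αm|f'(a/m)|^q)/(α+1), (|f'(a)|^q + αm|f'((a+mb)/(2m))|^q)/(α+1) }, we have |(f(a)+f(mb))/2 − (1/(mb−a)) ∫ₐ^{mb} f(x) dx| ≤ ((mb−a)/4)(1/(p+1))^{1/p} (A₁^{1/q} + B₁^{1/q}).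 -/
open MeasureTheory Set Real

/-- Hölder's inequality against the weight `s` on `[0,1]`, for a function dominated by `g ^ (1/q)`. -/
lemma abs_integral_id_mul_le {p q : ℝ} (hpq : p.HolderConjugate q) {u g : ℝ → ℝ}
    (hg : Continuous g) (hug : ∀ s ∈ Icc (0:ℝ) 1, |u s| ^ q ≤ g s) :
    |∫ s in (0:ℝ)..1, s * u s| ≤ (1 / (p + 1)) ^ (1 / p) * (∫ s in (0:ℝ)..1, g s) ^ (1 / q) := by
  have hp := hpq.pos
  have hq := hpq.symm.pos
  have hg0 : ∀ s ∈ Icc (0:ℝ) 1, 0 ≤ g s := fun s hs => le_trans (by positivity) (hug s hs)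
  have hcont : Continuous fun s => g s ^ (1 / q) :=
    hg.rpow_const fun _ => Or.inr (by positivity)
  have hdom : |∫ s in (0:ℝ)..1, s * u s| ≤ ∫ s in (0:ℝ)..1, s * g s ^ (1 / q) := by
    rw [← Real.norm_eq_abs]
    refine intervalIntegral.norm_integral_le_of_norm_le zero_le_one
      (Filter.Eventually.of_forall fun s hs => ?_)
      ((continuous_id.mul hcont).intervalIntegrable 0 1)
    have hs' := Ioc_subset_Icc_self hs
    rw [norm_mul, Real.norm_of_nonneg hs.1.le, Real.norm_eq_abs]
    refine mul_le_mul_of_nonneg_left ?_ hs.1.le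
    rw [one_div]
    exact (Real.le_rpow_inv_iff_of_pos (abs_nonneg _) (hg0 s hs') hq).2 (hug s hs')
  refine hdom.trans ?_
  have memLp_of_continuous : ∀ {r : ℝ} {w : ℝ → ℝ}, Continuous w →
      MemLp w (ENNReal.ofReal r) (volume.restrict (Ioc (0:ℝ) 1)) := fun {r w} hw => by
    obtain ⟨C, hC⟩ := isCompact_Icc.exists_bound_of_continuousOn (s := Icc (0:ℝ) 1) hw.continuousOn
    refine MemLp.of_bound hw.aestronglyMeasurable C ?_
    filter_upwards [ae_restrict_mem measurableSet_Ioc] with s hs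
    exact hC s (Ioc_subset_Icc_self hs)
  have hH := integral_mul_le_Lp_mul_Lq_of_nonneg (μ := volume.restrict (Ioc (0:ℝ) 1)) hpq
    (f := fun s => s) (g := fun s => g s ^ (1 / q))
    (by filter_upwards [ae_restrict_mem measurableSet_Ioc] with s hs using hs.1.le)
    (by
      filter_upwards [ae_restrict_mem measurableSet_Ioc] with s hs
      exact Real.rpow_nonneg (hg0 s (Ioc_subset_Icc_self hs)) _)
    (memLp_of_continuous continuous_id) (memLp_of_continuous hcont)
  have hpow : ∫ s in Ioc (0:ℝ) 1, s ^ p = 1 / (p + 1) := by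
    rw [← intervalIntegral.integral_of_le zero_le_one, integral_rpow (Or.inl (by linarith)),
      Real.one_rpow, Real.zero_rpow (by linarith), sub_zero]
  have hgq : ∫ s in Ioc (0:ℝ) 1, (g s ^ (1 / q)) ^ q = ∫ s in Ioc (0:ℝ) 1, g s :=
    setIntegral_congr_fun measurableSet_Ioc fun s hs => by
      rw [← Real.rpow_mul (hg0 s (Ioc_subset_Icc_self hs)), one_div_mul_cancel hq.ne',
        Real.rpow_one]
  rw [intervalIntegral.integral_of_le zero_le_one, intervalIntegral.integral_of_le zero_le_one]
  simpa only [hpow, hgq] using hH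

lemma abs_integral_sub_mul_le_s13 {p q : ℝ} (hpq : p.HolderConjugate q) {F g : ℝ → ℝ} (c : ℝ) {h : ℝ}
    (hh : h ≠ 0) (hg : Continuous g) (hFg : ∀ s ∈ Icc (0:ℝ) 1, |F (h * s + c)| ^ q ≤ g s) :
    |∫ x in c..(h + c), (x - c) * F x| ≤
      h ^ 2 * ((1 / (p + 1)) ^ (1 / p) * (∫ s in (0:ℝ)..1, g s) ^ (1 / q)) := by
  have hsub := intervalIntegral.integral_comp_mul_add (a := 0) (b := 1)
    (fun x => (x - c) * F x) hh c
  have hfactor : ∫ s in (0:ℝ)..1, (h * s + c - c) * F (h * s + c) =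
      h * ∫ s in (0:ℝ)..1, s * F (h * s + c) := by
    rw [← intervalIntegral.integral_const_mul]
    congr 1
    ext s
    ring
  simp only [hfactor, mul_zero, zero_add, mul_one, smul_eq_mul] at hsub
  have heq : ∫ x in c..(h + c), (x - c) * F x = h ^ 2 * ∫ s in (0:ℝ)..1, s * F (h * s + c) := by
    rw [eq_inv_mul_iff_mul_eq₀ hh] at hsub
    rw [← hsub]
    ring
  rw [heq, abs_mul, abs_of_nonneg (sq_nonneg h)]
  exact mul_le_mul_of_nonneg_left (abs_integral_id_mul_le hpq hg hFg) (sq_nonneg h)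

lemma continuous_rpow_weight {α : ℝ} (hα : 0 < α) (m P Q : ℝ) :
    Continuous fun t : ℝ => t ^ α * P + m * (1 - t ^ α) * Q := by
  have := Real.continuous_rpow_const hα.le
  fun_prop

lemma integral_rpow_weight {α : ℝ} (hα : 0 < α) (m P Q : ℝ) :
    ∫ t in (0:ℝ)..1, (t ^ α * P + m * (1 - t ^ α) * Q) = (P + α * m * Q) / (α + 1) := by
  have hrew : ∀ t : ℝ, t ^ α * P + m * (1 - t ^ α) * Q = (P - m * Q) * t ^ α + m * Q :=
    fun t => by ring
  have hi : IntervalIntegrable (fun t : ℝ => (P - m * Q) * t ^ α) volume 0 1 :=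
    ((Real.continuous_rpow_const hα.le).const_mul _).intervalIntegrable 0 1
  simp only [hrew]
  rw [intervalIntegral.integral_add hi intervalIntegrable_const,
    intervalIntegral.integral_const_mul, integral_rpow (Or.inl (by linarith)),
    intervalIntegral.integral_const, Real.one_rpow, Real.zero_rpow (by linarith)]
  simp only [smul_eq_mul]
  field_simp
  ring

/-- The first hypothesis compares `F` with the `(α,m)`-weights growing away from `c`, the second
with those growing towards `c`. -/
lemma abs_integral_sub_mul_le_min {p q α m : ℝ} (hpq : p.HolderConjugate q) (hα : 0 < α)
    {F : ℝ → ℝ} (c : ℝ) {h : ℝ} (hh : h ≠ 0) {P Q P' Q' : ℝ}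
    (hout : ∀ t ∈ Icc (0:ℝ) 1, |F (h * t + c)| ^ q ≤ t ^ α * P + m * (1 - t ^ α) * Q)
    (hin : ∀ t ∈ Icc (0:ℝ) 1, |F (h * (1 - t) + c)| ^ q ≤ t ^ α * P' + m * (1 - t ^ α) * Q') :
    |∫ x in c..(h + c), (x - c) * F x| ≤ h ^ 2 * ((1 / (p + 1)) ^ (1 / p) *
      (min ((P' + α * m * Q') / (α + 1)) ((P + α * m * Q) / (α + 1))) ^ (1 / q)) := by
  rcases min_choice ((P' + α * m * Q') / (α + 1)) ((P + α * m * Q) / (α + 1)) with hmin | hmin <;>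
    rw [hmin]
  · have hbound := abs_integral_sub_mul_le_s13 hpq c hh
      ((continuous_rpow_weight hα m P' Q').comp (continuous_const.sub continuous_id))
      (F := F) (g := (fun t : ℝ => t ^ α * P' + m * (1 - t ^ α) * Q') ∘ fun t => 1 - t)
      fun s hs => by
        have := hin (1 - s) ⟨by linarith [hs.2], by linarith [hs.1]⟩
        rwa [sub_sub_cancel] at this
    have hint := intervalIntegral.integral_comp_sub_left (a := 0) (b := 1)
      (fun t : ℝ => t ^ α * P' + m * (1 - t ^ α) * Q') 1
    rw [sub_self, sub_zero, integral_rpow_weight hα] at hint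
    simp only [Function.comp_apply] at hbound
    rwa [hint] at hbound
  · rw [← integral_rpow_weight hα]
    exact abs_integral_sub_mul_le_s13 hpq c hh (continuous_rpow_weight hα m P Q) hout

lemma integral_sub_midpoint_mul_deriv {f f' : ℝ → ℝ} {a d : ℝ}
    (hf : ∀ x ∈ uIcc a d, HasDerivAt f (f' x) x) (hint : IntervalIntegrable f' volume a d) :
    ∫ x in a..d, (x - (a + d) / 2) * f' x = (d - a) / 2 * (f a + f d) - ∫ x in a..d, f x := by
  have hparts := intervalIntegral.integral_mul_deriv_eq_deriv_mul
    (u := fun x => x - (a + d) / 2) (u' := fun _ => 1) (v := f) (v' := f')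
    (fun x _ => (hasDerivAt_id x).sub_const _) hf intervalIntegrable_const hint
  simp only [one_mul] at hparts
  rw [hparts]
  ring

theorem trapezoid_holder (I : Set ℝ) (hI : I.OrdConnected) (hI0 : I ⊆ Ici (0:ℝ))
    (f f' : ℝ → ℝ) (a b m α p q : ℝ)
    (ha : a ∈ interior I) (hb : b ∈ interior I) (hab : a < b)
    (hα : α ∈ Ioc (0:ℝ) 1) (hm : m ∈ Ioc (0:ℝ) 1) (hmb : a < m * b)
    (hq : 1 < q) (hpq : 1 / p + 1 / q = 1)
    (hdiff : ∀ x ∈ interior I, HasDerivAt f (f' x) x)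
    (hint : IntervalIntegrable f' volume a b)
    (hconv : AlphaMConvexOn (Icc a b) α m (fun x => |f' x| ^ q))
    (A1 B1 : ℝ)
    (hA1 : A1 = min
        ((|f' ((a + m * b) / 2)| ^ q + α * m * |f' b| ^ q) / (α + 1))
        ((|f' (m * b)| ^ q + α * m * |f' ((a + m * b) / (2 * m))| ^ q) / (α + 1)))
    (hB1 : B1 = min
        ((|f' ((a + m * b) / 2)| ^ q + α * m * |f' (a / m)| ^ q) / (α + 1))
        ((|f' a| ^ q + α * m * |f' ((a + m * b) / (2 * m))| ^ q) / (α + 1))) :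
    |(f a + f (m * b)) / 2 - (1 / (m * b - a)) * ∫ x in a..(m * b), f x|
      ≤ ((m * b - a) / 4) * (1 / (p + 1)) ^ (1 / p) *
        (A1 ^ (1 / q) + B1 ^ (1 / q)) := by
  have hpq' : p.HolderConjugate q := by
    refine (Real.holderConjugate_iff.2 ⟨hq, ?_⟩).symm
    rw [← hpq]
    ring
  obtain ⟨hα0, -⟩ := hα
  obtain ⟨hm0, hm1⟩ := hm
  have ha0 : 0 ≤ a := hI0 (interior_subset ha)
  have hmb_le : m * b ≤ b := by nlinarith
  have ha_le : a ≤ a / m := by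
    rw [le_div_iff₀ hm0]
    nlinarith
  have ham_lt : a / m < b := by
    rw [div_lt_iff₀ hm0]
    linarith
  have hmid : (a + m * b) / (2 * m) = (a / m + b) / 2 := by
    field_simp
  have hmid_mem : (a + m * b) / (2 * m) ∈ Icc a b := by
    rw [hmid]
    constructor <;> linarith
  have hm_mid : m * ((a + m * b) / (2 * m)) = (a + m * b) / 2 := by
    field_simp
  have hm_a : m * (a / m) = a := mul_div_cancel₀ a hm0.ne'
  set c := (a + m * b) / 2 with hc
  set e := (a + m * b) / (2 * m)
  have hc_mem : c ∈ Icc a b := by constructor <;> linarith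
  have hsub : uIcc a (m * b) ⊆ interior I := by
    rw [uIcc_of_le hmb.le]
    exact (Icc_subset_Icc_right hmb_le).trans (hI.interior.out ha hb)
  have hint' : IntervalIntegrable f' volume a (m * b) :=
    hint.mono_set (by
      rw [uIcc_of_le hmb.le, uIcc_of_le hab.le]
      exact Icc_subset_Icc_right hmb_le)
  have hker : IntervalIntegrable (fun x => (x - c) * f' x) volume a (m * b) :=
    hint'.continuousOn_mul (by fun_prop)
  have hc_uIcc : c ∈ uIcc a (m * b) := by
    rw [uIcc_of_le hmb.le]
    constructor <;> linarith
  have hsplit := intervalIntegral.integral_add_adjacent_intervals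
    (hker.mono_set (uIcc_subset_uIcc_left hc_uIcc))
    (hker.mono_set (uIcc_subset_uIcc_right hc_uIcc))
  have hright := abs_integral_sub_mul_le_min hpq' hα0 (F := f') (m := m) c
    (h := (m * b - a) / 2) (by linarith)
    (P := |f' (m * b)| ^ q) (Q := |f' e| ^ q) (P' := |f' c| ^ q) (Q' := |f' b| ^ q)
    (fun t ht => by
      have := hconv (m * b) ⟨hmb.le, hmb_le⟩ e hmid_mem t ht
      rwa [show t * (m * b) + m * (1 - t) * e = (m * b - a) / 2 * t + c by
        linear_combination (1 - t) * hm_mid - t * hc] at this)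
    (fun t ht => by
      have := hconv c hc_mem b ⟨hab.le, le_rfl⟩ t ht
      rwa [show t * c + m * (1 - t) * b = (m * b - a) / 2 * (1 - t) + c by
        linear_combination (t - 1) * hc] at this)
  have hleft := abs_integral_sub_mul_le_min hpq' hα0 (F := f') (m := m) c
    (h := (a - m * b) / 2) (by linarith)
    (P := |f' a| ^ q) (Q := |f' e| ^ q) (P' := |f' c| ^ q) (Q' := |f' (a / m)| ^ q)
    (fun t ht => by
      have := hconv a ⟨le_rfl, hab.le⟩ e hmid_mem t ht
      rwa [show t * a + m * (1 - t) * e = (a - m * b) / 2 * t + c by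
        linear_combination (1 - t) * hm_mid - t * hc] at this)
    (fun t ht => by
      have := hconv c hc_mem (a / m) ⟨ha_le, ham_lt.le⟩ t ht
      rwa [show t * c + m * (1 - t) * (a / m) = (a - m * b) / 2 * (1 - t) + c by
        linear_combination (1 - t) * hm_a + (t - 1) * hc] at this)
  rw [← hA1, show (m * b - a) / 2 + c = m * b by rw [hc]; ring] at hright
  rw [← hB1, show (a - m * b) / 2 + c = a by rw [hc]; ring, intervalIntegral.integral_symm,
    abs_neg] at hleft
  rw [integral_sub_midpoint_mul_deriv (fun x hx => hdiff x (hsub hx)) hint'] at hsplit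
  have hL : 0 < m * b - a := sub_pos.2 hmb
  have hrepr : (f a + f (m * b)) / 2 - (1 / (m * b - a)) * ∫ x in a..(m * b), f x =
      ((∫ x in a..c, (x - c) * f' x) + ∫ x in c..(m * b), (x - c) * f' x) / (m * b - a) := by
    rw [hsplit]
    field_simp
  rw [hrepr, abs_div, abs_of_pos hL, div_le_iff₀ hL]
  refine (abs_add_le _ _).trans ((add_le_add hleft hright).trans_eq ?_)
  ring
end

section
/- Let f : I ⊆ [0,∞) → ℝ be differentiable on I° with f' integrable on [a,b], where a,b ∈ I° with a < b, and suppose |f'|^q is (α,m)-convex on [a,b] for (α,m) ∈ (0,1]² with mb > a, where q > 1 and 1/p + 1/q = 1. With A₁ = min{ (|f'((a+mb)/2)|^q + αm|f'(b)|^q)/(α+1), (|f'(mb)|^q + αm|f'((a+mb)/(2m))|^q)/(α+1) } and B₁ = min{ (|f'((a+mb)/2)|^q + αm|f'(a/m)|^q)/(α+1), (|f'(a)|^q + αm|f'((a+mb)/(2m))|^q)/(α+1) }, we have |f((a+mb)/2) − (1/(mb−a)) ∫ₐ^{mb} f(x) dx| ≤ ((mb−a)/4)(1/(p+1))^{1/p}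 (A₁^{1/q} + B₁^{1/q}). -/
open MeasureTheory Set Real

/-- Integration by parts on a segment, parametrised by the unit interval. -/
theorem eq_average_add_integral_deriv_segment {f f' : ℝ → ℝ} {u v : ℝ} (huv : u ≠ v)
    (hd : ∀ x ∈ uIcc v u, HasDerivAt f (f' x) x)
    (hi : IntervalIntegrable (fun t => f' (t * u + (1 - t) * v)) volume 0 1) :
    f u = (u - v)⁻¹ * (∫ x in v..u, f x) +
      (u - v) * ∫ t in (0:ℝ)..1, t * f' (t * u + (1 - t) * v) := by
  have hmem : ∀ t ∈ uIcc (0:ℝ) 1, t * u + (1 - t) * v ∈ uIcc v u := by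
    intro t ht
    rw [uIcc_of_le zero_le_one] at ht
    rw [← segment_eq_uIcc]
    exact ⟨1 - t, t, by linarith [ht.2], ht.1, by ring, by simp only [smul_eq_mul]; ring⟩
  have hline : ∀ t : ℝ, HasDerivAt (fun t : ℝ => t * u + (1 - t) * v) (u - v) t := by
    intro t
    have h := ((hasDerivAt_id t).mul_const u).add (((hasDerivAt_id t).const_sub 1).mul_const v)
    exact h.congr_deriv (by ring)
  have hcomp : ∀ t ∈ uIcc (0:ℝ) 1, HasDerivAt (fun t => f (t * u + (1 - t) * v))
      (f' (t * u + (1 - t) * v) * (u - v)) t := fun t ht =>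
    (hd _ (hmem t ht)).comp t (hline t)
  have hparts := intervalIntegral.integral_mul_deriv_eq_deriv_mul
    (fun t _ => hasDerivAt_id t) hcomp intervalIntegrable_const (hi.mul_const (u - v))
  have hsubst : ∫ t in (0:ℝ)..1, f (t * u + (1 - t) * v) = (u - v)⁻¹ * ∫ x in v..u, f x := by
    have h := intervalIntegral.integral_comp_mul_add (a := 0) (b := 1) f (sub_ne_zero.2 huv) v
    simp only [mul_zero, zero_add, mul_one, sub_add_cancel, smul_eq_mul] at h
    rw [← h]
    congr 1
    ext t
    congr 1
    ring
  have hconst : ∫ t in (0:ℝ)..1, t * (f' (t * u + (1 - t) * v) * (u - v)) =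
      (u - v) * ∫ t in (0:ℝ)..1, t * f' (t * u + (1 - t) * v) := by
    rw [← intervalIntegral.integral_const_mul]
    congr 1
    ext t
    ring
  simp only [id, one_mul, zero_mul, sub_zero, sub_self, add_zero, hsubst, hconst] at hparts
  linarith

theorem IntervalIntegrable.comp_segment {g : ℝ → ℝ} {u v : ℝ} (huv : u ≠ v)
    (hg : IntervalIntegrable g volume v u) :
    IntervalIntegrable (fun t => g (t * u + (1 - t) * v)) volume 0 1 := by
  have h0 : u - v ≠ 0 := sub_ne_zero.2 huv
  have h := (hg.comp_add_right v).comp_mul_left (c := u - v)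
  simp only [sub_self, zero_div, div_self h0] at h
  convert h using 2 with t
  ring_nf

theorem AlphaMConvexOn.integral_segment_le {s : Set ℝ} {α m : ℝ} {g : ℝ → ℝ}
    (hg : AlphaMConvexOn s α m g) (hα : 0 < α) {x y : ℝ} (hx : x ∈ s) (hy : y ∈ s)
    (hi : IntervalIntegrable (fun t => g (t * x + m * (1 - t) * y)) volume 0 1) :
    ∫ t in (0:ℝ)..1, g (t * x + m * (1 - t) * y) ≤ (g x + α * m * g y) / (α + 1) := by
  have hpow : IntervalIntegrable (fun t : ℝ => t ^ α) volume 0 1 :=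
    intervalIntegral.intervalIntegrable_rpow' (by linarith)
  have h1 : IntervalIntegrable (fun t : ℝ => t ^ α * g x) volume 0 1 := hpow.mul_const _
  have h2 : IntervalIntegrable (fun t : ℝ => m * (1 - t ^ α) * g y) volume 0 1 :=
    ((intervalIntegrable_const.sub hpow).const_mul m).mul_const _
  refine (intervalIntegral.integral_mono_on zero_le_one hi (h1.add h2)
    (fun t ht => hg x hx y hy t ht)).trans_eq ?_
  rw [intervalIntegral.integral_add h1 h2, intervalIntegral.integral_mul_const,
    intervalIntegral.integral_mul_const, intervalIntegral.integral_const_mul,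
    intervalIntegral.integral_sub intervalIntegrable_const hpow,
    integral_rpow (Or.inl (by linarith)), Real.zero_rpow (by linarith)]
  simp only [one_rpow, intervalIntegral.integral_const, smul_eq_mul]
  field_simp
  ring

theorem abs_integral_id_mul_le_of_bounded {φ : ℝ → ℝ} {p q C : ℝ} (hpq : p.HolderConjugate q)
    (hφ : IntervalIntegrable φ volume 0 1) (hC : ∀ t ∈ Icc (0:ℝ) 1, |φ t| ≤ C) :
    |∫ t in (0:ℝ)..1, t * φ t| ≤
      (1 / (p + 1)) ^ (1 / p) * (∫ t in (0:ℝ)..1, |φ t| ^ q) ^ (1 / q) := by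
  have hmeas : AEStronglyMeasurable φ (volume.restrict (Ioc 0 1)) := hφ.1.aestronglyMeasurable
  have hφq : MemLp (fun t => |φ t|) (ENNReal.ofReal q) (volume.restrict (Ioc (0:ℝ) 1)) := by
    refine MemLp.of_bound hmeas.norm C ?_
    filter_upwards [ae_restrict_mem measurableSet_Ioc] with t ht
    simpa using hC t (Ioc_subset_Icc_self ht)
  have hidp : MemLp (fun t : ℝ => t) (ENNReal.ofReal p) (volume.restrict (Ioc (0:ℝ) 1)) := by
    refine MemLp.of_bound continuous_id.aestronglyMeasurable 1 ?_
    filter_upwards [ae_restrict_mem measurableSet_Ioc] with t ht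
    rw [Real.norm_eq_abs, abs_of_pos ht.1]
    exact ht.2
  have hid : ∫ t in (0:ℝ)..1, t ^ p = 1 / (p + 1) := by
    rw [integral_rpow (Or.inl (by linarith [hpq.pos])), one_rpow,
      Real.zero_rpow (by linarith [hpq.pos]), sub_zero]
  have hholder := integral_mul_le_Lp_mul_Lq_of_nonneg hpq
    (by filter_upwards [ae_restrict_mem measurableSet_Ioc] with t ht using ht.1.le)
    (Filter.Eventually.of_forall fun t => abs_nonneg (φ t)) hidp hφq
  simp only [← intervalIntegral.integral_of_le (zero_le_one' ℝ), hid] at hholder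
  refine (intervalIntegral.abs_integral_le_integral_abs zero_le_one).trans
    (le_of_eq_of_le ?_ hholder)
  refine intervalIntegral.integral_congr fun t ht => ?_
  rw [uIcc_of_le zero_le_one] at ht
  simp only [abs_mul, abs_of_nonneg ht.1]

theorem AlphaMConvexOn.exists_bound_segment {s : Set ℝ} {α m q : ℝ} {φ : ℝ → ℝ}
    (hg : AlphaMConvexOn s α m (fun x => |φ x| ^ q)) (hα : 0 < α) (hm : 0 < m) (hq : 0 < q)
    {x y : ℝ} (hx : x ∈ s) (hy : y ∈ s) :
    ∃ C, ∀ t ∈ Icc (0:ℝ) 1, |φ (t * x + m * (1 - t) * y)| ≤ C := by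
  refine ⟨(|φ x| ^ q + m * |φ y| ^ q) ^ (1 / q), fun t ht => ?_⟩
  have hX : 0 ≤ |φ x| ^ q := by positivity
  have hY : 0 ≤ m * |φ y| ^ q := by positivity
  have ht0 : 0 ≤ t ^ α := rpow_nonneg ht.1 α
  have ht1 : t ^ α ≤ 1 := rpow_le_one ht.1 ht.2 hα.le
  rw [one_div, Real.le_rpow_inv_iff_of_pos (abs_nonneg _) (by positivity) hq]
  refine (hg x hx y hy t ht).trans ?_
  nlinarith [mul_nonneg ht0 hY, mul_nonneg (sub_nonneg.2 ht1) hX]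

/-- The Hölder inequality on the segment from `v` to `u`, with the `(α,m)`-convexity bound applied
from either endpoint. -/
theorem AlphaMConvexOn.abs_integral_id_mul_segment_le {s : Set ℝ} {α m p q : ℝ} {φ : ℝ → ℝ}
    (hg : AlphaMConvexOn s α m (fun x => |φ x| ^ q)) (hα : 0 < α) (hm : 0 < m)
    (hpq : p.HolderConjugate q) {u v : ℝ} (hu : u ∈ s) (hv : v ∈ s)
    (hum : u / m ∈ s) (hvm : v / m ∈ s)
    (hi : IntervalIntegrable (fun t => φ (t * u + (1 - t) * v)) volume 0 1) :
    |∫ t in (0:ℝ)..1, t * φ (t * u + (1 - t) * v)| ≤ (1 / (p + 1)) ^ (1 / p) *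
      (min ((|φ u| ^ q + α * m * |φ (v / m)| ^ q) / (α + 1))
        ((|φ v| ^ q + α * m * |φ (u / m)| ^ q) / (α + 1))) ^ (1 / q) := by
  have hp := hpq.pos
  have hq := hpq.symm.pos
  have hcancel : ∀ t w : ℝ, m * (1 - t) * (w / m) = (1 - t) * w := fun t w => by
    field_simp
  obtain ⟨C, hC⟩ := hg.exists_bound_segment hα hm hq hu hvm
  simp only [hcancel] at hC
  have hJ : IntervalIntegrable (fun t => |φ (t * u + (1 - t) * v)| ^ q) volume 0 1 := by
    rw [intervalIntegrable_iff_integrableOn_Ioc_of_le zero_le_one] at hi ⊢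
    refine Integrable.of_bound
      (hi.aestronglyMeasurable.norm.aemeasurable.pow_const q).aestronglyMeasurable (C ^ q) ?_
    filter_upwards [ae_restrict_mem measurableSet_Ioc] with t ht
    rw [Real.norm_eq_abs, abs_of_nonneg (by positivity)]
    exact rpow_le_rpow (abs_nonneg _) (hC t (Ioc_subset_Icc_self ht)) hq.le
  have hflip : ∀ t : ℝ, (1 - t) * u + (1 - (1 - t)) * v = t * v + (1 - t) * u := fun t => by
    ring
  have hJ' : IntervalIntegrable (fun t => |φ (t * v + (1 - t) * u)| ^ q) volume 0 1 := by
    have h := (hJ.comp_sub_left 1).symm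
    simp only [hflip, sub_zero, sub_self] at h
    exact h
  have hJeq : ∫ t in (0:ℝ)..1, |φ (t * v + (1 - t) * u)| ^ q =
      ∫ t in (0:ℝ)..1, |φ (t * u + (1 - t) * v)| ^ q := by
    have h := intervalIntegral.integral_comp_sub_left (a := 0) (b := 1)
      (fun t => |φ (t * u + (1 - t) * v)| ^ q) 1
    simp only [hflip, sub_zero, sub_self] at h
    exact h
  refine (abs_integral_id_mul_le_of_bounded hpq hi hC).trans ?_
  refine mul_le_mul_of_nonneg_left (rpow_le_rpow ?_ (le_min ?_ ?_) (by positivity))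
    (by positivity)
  · exact intervalIntegral.integral_nonneg zero_le_one fun t _ => by positivity
  · have h := hg.integral_segment_le hα hu hvm
    simp only [hcancel] at h
    exact h hJ
  · have h := hg.integral_segment_le hα hv hum
    simp only [hcancel] at h
    exact hJeq ▸ h hJ'

theorem midpoint_holder (I : Set ℝ) (hI : I.OrdConnected) (hI0 : I ⊆ Ici (0:ℝ))
    (f f' : ℝ → ℝ) (a b m α p q : ℝ)
    (ha : a ∈ interior I) (hb : b ∈ interior I) (hab : a < b)
    (hα : α ∈ Ioc (0:ℝ) 1) (hm : m ∈ Ioc (0:ℝ) 1) (hmb : a < m * b)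
    (hq : 1 < q) (hpq : 1 / p + 1 / q = 1)
    (hdiff : ∀ x ∈ interior I, HasDerivAt f (f' x) x)
    (hint : IntervalIntegrable f' volume a b)
    (hconv : AlphaMConvexOn (Icc a b) α m (fun x => |f' x| ^ q))
    (A1 B1 : ℝ)
    (hA1 : A1 = min
        ((|f' ((a + m * b) / 2)| ^ q + α * m * |f' b| ^ q) / (α + 1))
        ((|f' (m * b)| ^ q + α * m * |f' ((a + m * b) / (2 * m))| ^ q) / (α + 1)))
    (hB1 : B1 = min
        ((|f' ((a + m * b) / 2)| ^ q + α * m * |f' (a / m)| ^ q) / (α + 1))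
        ((|f' a| ^ q + α * m * |f' ((a + m * b) / (2 * m))| ^ q) / (α + 1))) :
    |f ((a + m * b) / 2) - (1 / (m * b - a)) * ∫ x in a..(m * b), f x|
      ≤ ((m * b - a) / 4) * (1 / (p + 1)) ^ (1 / p) *
        (A1 ^ (1 / q) + B1 ^ (1 / q)) := by
  obtain ⟨hα0, -⟩ := hα
  obtain ⟨hm0, hm1⟩ := hm
  have hpq' : p.HolderConjugate q :=
    (Real.holderConjugate_iff.2 ⟨hq, by simpa [add_comm] using hpq⟩).symm
  have ha0 : 0 ≤ a := hI0 (interior_subset ha)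
  have hmb' : m * b ≤ b := by nlinarith
  set c := (a + m * b) / 2 with hc
  have hac : a < c := by linarith
  have hcb : c < m * b := by linarith
  have hdiv : ∀ x, a ≤ x → x ≤ m * b → x / m ∈ Icc a b := fun x hx hx' =>
    ⟨by rw [le_div_iff₀ hm0]; nlinarith, by rw [div_le_iff₀ hm0]; linarith⟩
  have hderiv : ∀ x ∈ Icc a (m * b), HasDerivAt f (f' x) x := fun x hx =>
    hdiff x (hI.interior.out ha hb ⟨hx.1, hx.2.trans hmb'⟩)
  have hint' : ∀ {x y}, x ∈ Icc a b → y ∈ Icc a b → IntervalIntegrable f' volume x y :=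
    fun hx hy => hint.mono_set <| by
      rw [uIcc_of_le hab.le]; exact uIcc_subset_Icc hx hy
  have hmem : ∀ x, a ≤ x → x ≤ m * b → x ∈ Icc a b := fun x hx hx' => ⟨hx, hx'.trans hmb'⟩
  have haI := hmem a le_rfl hmb.le
  have hcI := hmem c hac.le hcb.le
  have hdI := hmem (m * b) hmb.le le_rfl
  have hiA := (hint' hdI hcI).comp_segment hcb.ne
  have hiB := (hint' haI hcI).comp_segment hac.ne'
  have hidA := eq_average_add_integral_deriv_segment hcb.ne (f := f)
    (fun x hx => hderiv x (uIcc_subset_Icc ⟨hmb.le, le_rfl⟩ ⟨hac.le, hcb.le⟩ hx)) hiA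
  have hidB := eq_average_add_integral_deriv_segment hac.ne' (f := f)
    (fun x hx => hderiv x (uIcc_subset_Icc ⟨le_rfl, hmb.le⟩ ⟨hac.le, hcb.le⟩ hx)) hiB
  have hA := hconv.abs_integral_id_mul_segment_le hα0 hm0 hpq' hcI hdI
    (hdiv c hac.le hcb.le) (hdiv _ hmb.le le_rfl) hiA
  have hB := hconv.abs_integral_id_mul_segment_le hα0 hm0 hpq' hcI haI
    (hdiv c hac.le hcb.le) (hdiv a le_rfl hmb.le) hiB
  have hcm : c / m = (a + m * b) / (2 * m) := by rw [hc, div_div]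
  rw [mul_div_cancel_left₀ b hm0.ne', hcm, ← hA1] at hA
  rw [hcm, ← hB1] at hB
  have hcont : ContinuousOn f (Icc a (m * b)) := fun x hx =>
    (hderiv x hx).continuousAt.continuousWithinAt
  have hsum : ∫ x in a..(m * b), f x = (∫ x in a..c, f x) + ∫ x in c..(m * b), f x :=
    (intervalIntegral.integral_add_adjacent_intervals
      ((hcont.mono (Icc_subset_Icc_right hcb.le)).intervalIntegrable_of_Icc hac.le)
      ((hcont.mono (Icc_subset_Icc_left hac.le)).intervalIntegrable_of_Icc hcb.le)).symm
  rw [intervalIntegral.integral_symm c (m * b),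
    show c - m * b = -((m * b - a) / 2) by rw [hc]; ring] at hidA
  rw [show c - a = (m * b - a) / 2 by rw [hc]; ring] at hidB
  have hL : 0 < m * b - a := by linarith
  set KA := ∫ t in (0:ℝ)..1, t * f' (t * c + (1 - t) * (m * b))
  set KB := ∫ t in (0:ℝ)..1, t * f' (t * c + (1 - t) * a)
  have hkey : f c - (1 / (m * b - a)) * ∫ x in a..(m * b), f x =
      (m * b - a) / 4 * (KB - KA) := by
    rw [hsum]
    field_simp at hidA hidB ⊢
    linarith
  rw [hkey, abs_mul, abs_of_pos (by positivity : 0 < (m * b - a) / 4), mul_assoc]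
  refine mul_le_mul_of_nonneg_left ?_ (by positivity)
  calc |KB - KA| ≤ |KB| + |KA| := abs_sub _ _
    _ ≤ _ := by rw [mul_add, add_comm]; exact add_le_add hA hB
end
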